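/- arXiv:1201.5157 — 10 statements merged into one kernel-verified Lean document; each statement's English description precedes it below -/
import Mathlib

section
/- For all reals n₁ > 1, d > 0 and k > 0, set θ = √(1 − 1/n₁²), M = n₁·k·d·θ and N = ⌊M/π⌋. Then for each j ∈ {1, …, N} the equation tan(y) = −y/√(M² − y²) has exactly one solution y in the set (π/2 + (j−1)π, π/2 + jπ) ∩ (0, M), and this equation has no solution y ∈ (0, M) with y ≤ π/2. -/
open Real

/-- θ = √(1 − 1/n₁²) -/
noncomputable def pekTheta (n₁ : ℝ) : ℝ := Real.sqrt (1 - 1 / n₁ ^ 2)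

/-- M = n₁·k·d·θ -/
noncomputable def pekM (n₁ d k : ℝ) : ℝ := n₁ * k * d * pekTheta n₁

/-- N = ⌊M/π⌋ -/
noncomputable def pekN (n₁ d k : ℝ) : ℕ := Nat.floor (pekM n₁ d k / Real.pi)

theorem pek_rhs_lt {M x y : ℝ} (hx : 0 < x) (hxy : x < y) (hy : y < M) :
    - y / Real.sqrt (M ^ 2 - y ^ 2) < - x / Real.sqrt (M ^ 2 - x ^ 2) := by
  have h1 : 0 < M ^ 2 - y ^ 2 := by nlinarith
  have h3 : Real.sqrt (M ^ 2 - y ^ 2) ≤ Real.sqrt (M ^ 2 - x ^ 2) :=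
    Real.sqrt_le_sqrt (by nlinarith)
  have h4 := Real.sqrt_pos.mpr h1
  rw [neg_div, neg_div, neg_lt_neg_iff]
  exact div_lt_div₀ hxy h3 (by linarith) h4

theorem pek_aux (M : ℝ) (j : ℕ) (hj : 1 ≤ j) (hM : (j : ℝ) * Real.pi ≤ M) :
    ∃! y : ℝ,
        (y ∈ Set.Ioo (Real.pi / 2 + ((j : ℝ) - 1) * Real.pi) (Real.pi / 2 + (j : ℝ) * Real.pi) ∧
          y ∈ Set.Ioo 0 M) ∧
        Real.tan y = - y / Real.sqrt (M ^ 2 - y ^ 2) := by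
  have hpi := Real.pi_pos
  have hj1 : (1 : ℝ) ≤ j := by exact_mod_cast hj
  have hjp : Real.pi ≤ j * Real.pi := by nlinarith
  have htan : ∀ y : ℝ, Real.tan y = Real.tan (y - j * Real.pi) := fun y =>
    (Real.tan_sub_nat_mul_pi y j).symm
  refine existsUnique_of_exists_of_unique ?_ ?_
  · have hc : ContinuousOn (fun s : ℝ => (s + j * Real.pi) * Real.cos s +
        Real.sin s * Real.sqrt (M ^ 2 - (s + j * Real.pi) ^ 2)) (Set.Icc (-(Real.pi / 2)) 0) := by
      fun_prop
    have hiv := intermediate_value_Ioo (by linarith : -(Real.pi / 2) ≤ 0) hc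
    have h0 : (0 : ℝ) ∈ Set.Ioo
        ((-(Real.pi / 2) + j * Real.pi) * Real.cos (-(Real.pi / 2)) +
          Real.sin (-(Real.pi / 2)) * Real.sqrt (M ^ 2 - (-(Real.pi / 2) + j * Real.pi) ^ 2))
        ((0 + j * Real.pi) * Real.cos 0 +
          Real.sin 0 * Real.sqrt (M ^ 2 - (0 + j * Real.pi) ^ 2)) := by
      have : 0 < Real.sqrt (M ^ 2 - (-(Real.pi / 2) + j * Real.pi) ^ 2) :=
        Real.sqrt_pos.mpr (by nlinarith)
      simp only [Real.cos_neg, Real.sin_neg, Real.cos_pi_div_two, Real.sin_pi_div_two,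
        Real.cos_zero, Real.sin_zero]
      constructor <;> linarith
    obtain ⟨s, ⟨hs1, hs2⟩, hs⟩ := hiv h0
    refine ⟨s + j * Real.pi, ⟨⟨by linarith, by linarith⟩, by linarith, by linarith⟩, ?_⟩
    have hcos : 0 < Real.cos s := Real.cos_pos_of_mem_Ioo ⟨hs1, by linarith⟩
    have hsq : 0 < Real.sqrt (M ^ 2 - (s + j * Real.pi) ^ 2) :=
      Real.sqrt_pos.mpr (by nlinarith)
    rw [htan, add_sub_cancel_right, Real.tan_eq_sin_div_cos, div_eq_div_iff hcos.ne' hsq.ne']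
    simp only at hs
    linarith
  · have key : ∀ x y : ℝ, Real.pi / 2 + ((j : ℝ) - 1) * Real.pi < x →
        y < Real.pi / 2 + (j : ℝ) * Real.pi → 0 < x → y < M → x < y →
        Real.tan x = - x / Real.sqrt (M ^ 2 - x ^ 2) →
        Real.tan y = - y / Real.sqrt (M ^ 2 - y ^ 2) → False := by
      intro x y hx hy hx0 hyM hxy ex ey
      have h1 := pek_rhs_lt hx0 hxy hyM
      have h2 : Real.tan (x - j * Real.pi) < Real.tan (y - j * Real.pi) :=
        Real.tan_lt_tan_of_lt_of_lt_pi_div_two (by linarith) (by linarith) (by linarith)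
      rw [← htan, ← htan] at h2
      linarith
    rintro x y ⟨⟨⟨a1, a2⟩, a3, a4⟩, a5⟩ ⟨⟨⟨b1, b2⟩, b3, b4⟩, b5⟩
    rcases lt_trichotomy x y with h | h | h
    · exact (key x y a1 b2 a3 b4 h a5 b5).elim
    · exact h
    · exact (key y x b1 a2 b3 a4 h b5 a5).elim

/-- For all reals `n₁ > 1`, `d > 0`, `k > 0`, with `M = n₁kd√(1−1/n₁²)` and `N = ⌊M/π⌋`:
for each `j ∈ {1,…,N}` the equation `tan y = −y/√(M²−y²)` has exactly one solution in
`(π/2 + (j−1)π, π/2 + jπ) ∩ (0, M)`, and no solution `y ∈ (0, M)` with `y ≤ π/2`. -/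
theorem pekeris_dispersion_unique_solutions (n₁ d k : ℝ)
    (hn : 1 < n₁) (hd : 0 < d) (hk : 0 < k) :
    (∀ j : ℕ, 1 ≤ j → j ≤ pekN n₁ d k →
      ∃! y : ℝ,
        (y ∈ Set.Ioo (Real.pi / 2 + ((j : ℝ) - 1) * Real.pi) (Real.pi / 2 + (j : ℝ) * Real.pi) ∧
          y ∈ Set.Ioo 0 (pekM n₁ d k)) ∧
        Real.tan y = - y / Real.sqrt ((pekM n₁ d k) ^ 2 - y ^ 2)) ∧
    (∀ y : ℝ, y ∈ Set.Ioo 0 (pekM n₁ d k) → y ≤ Real.pi / 2 →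
      Real.tan y ≠ - y / Real.sqrt ((pekM n₁ d k) ^ 2 - y ^ 2)) := by
  constructor
  · intro j hj hjN
    refine pek_aux _ j hj ?_
    have h := (Nat.le_floor_iff' (by omega)).mp hjN
    exact (le_div_iff₀ Real.pi_pos).mp h
  · rintro y ⟨hy0, hyM⟩ hy h
    have h1 := Real.tan_nonneg_of_nonneg_of_le_pi_div_two hy0.le hy
    have h2 : 0 < Real.sqrt ((pekM n₁ d k) ^ 2 - y ^ 2) := Real.sqrt_pos.mpr (by nlinarith)
    have h3 := div_pos hy0 h2
    rw [h, neg_div] at h1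
    linarith
end

section
/- For every α ∈ (1/3, 1) and all reals n₁ > 1, d > 0, there exist constants C > 0 and k₀ > 0 such that for every k ≥ k₀ and every j ∈ {1, …, N − ⌊N^α⌋ − 1} one has |σ_{j+1} − σ_j − π| ≤ C·N^{(1−3α)/2}. -/
open Real Filter MeasureTheory

/-- `σ : ℕ → ℝ` enumerates the solutions of the dispersion relation
`tan y = −y/√(M² − y²)`, with `σ j` the unique solution in
`(π/2 + (j−1)π, π/2 + jπ) ∩ (0, M)`, for `j = 1, …, N`. -/
def IsModeFamily (n₁ d k : ℝ) (σ : ℕ → ℝ) : Prop :=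
  ∀ j : ℕ, 1 ≤ j → j ≤ pekN n₁ d k →
    σ j ∈ Set.Ioo (Real.pi / 2 + ((j : ℝ) - 1) * Real.pi) (Real.pi / 2 + (j : ℝ) * Real.pi) ∧
    σ j ∈ Set.Ioo 0 (pekM n₁ d k) ∧
    Real.tan (σ j) = - σ j / Real.sqrt ((pekM n₁ d k) ^ 2 - (σ j) ^ 2)

/-- ζ_j = √(M² − σ_j²) -/
noncomputable def pekZeta (n₁ d k y : ℝ) : ℝ := Real.sqrt ((pekM n₁ d k) ^ 2 - y ^ 2)

/-- A_j = √( (2/d) / (1 + sin²(σ_j)/ζ_j − sin(2σ_j)/(2σ_j)) ) -/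
noncomputable def pekA (n₁ d k y : ℝ) : ℝ :=
  Real.sqrt ((2 / d) /
    (1 + Real.sin y ^ 2 / pekZeta n₁ d k y - Real.sin (2 * y) / (2 * y)))

/-- The propagating mode profile φ_j. -/
noncomputable def pekPhi (n₁ d k y : ℝ) : ℝ → ℝ := fun x =>
  if x ≤ d then pekA n₁ d k y * Real.sin (y * x / d)
  else pekA n₁ d k y * Real.sin y * Real.exp (- pekZeta n₁ d k y * (x - d) / d)

/-- The phase a = jπ − y of a solution satisfies sin a = y/M, cos a = √(M²−y²)/M. -/
theorem pek_phase (M y : ℝ) (j : ℕ) (hy0 : 0 < y) (hyM : y < M)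
    (h1 : Real.pi / 2 + ((j : ℝ) - 1) * Real.pi < y) (h2 : y < Real.pi / 2 + (j : ℝ) * Real.pi)
    (ht : Real.tan y = - y / Real.sqrt (M ^ 2 - y ^ 2)) :
    Real.sin (j * Real.pi - y) = y / M ∧
      Real.cos (j * Real.pi - y) = Real.sqrt (M ^ 2 - y ^ 2) / M ∧
      0 < (j : ℝ) * Real.pi - y ∧ (j : ℝ) * Real.pi - y < Real.pi / 2 := by
  have hM : 0 < M := hy0.trans hyM
  have hpos : 0 < M ^ 2 - y ^ 2 := by nlinarith
  set z := Real.sqrt (M ^ 2 - y ^ 2) with hz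
  have hzpos : 0 < z := Real.sqrt_pos.mpr hpos
  have hz2 : z ^ 2 = M ^ 2 - y ^ 2 := Real.sq_sqrt hpos.le
  set a := (j : ℝ) * Real.pi - y with ha
  have ha1 : -(Real.pi / 2) < a := by rw [ha]; linarith
  have ha2 : a < Real.pi / 2 := by rw [ha]; linarith
  have hcos : 0 < Real.cos a := Real.cos_pos_of_mem_Ioo ⟨ha1, ha2⟩
  have htan : Real.tan a = y / z := by
    rw [ha, Real.tan_nat_mul_pi_sub, ht]; ring
  have hsin : Real.sin a = Real.cos a * y / z := by
    rw [Real.tan_eq_sin_div_cos] at htan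
    field_simp at htan ⊢
    linarith
  have hc : Real.cos a = z / M := by
    have h := Real.sin_sq_add_cos_sq a
    rw [hsin] at h
    field_simp at h
    have : (Real.cos a * M) ^ 2 = z ^ 2 := by
      have : y ^ 2 = M ^ 2 - z ^ 2 := by linarith
      rw [this] at h
      linarith
    have := (pow_left_inj₀ (by positivity) hzpos.le (by norm_num)).mp this
    field_simp
    linarith
  have hs : Real.sin a = y / M := by
    rw [hsin, hc]; field_simp
  refine ⟨hs, hc, ?_, ha2⟩
  by_contra hneg
  have : Real.sin a ≤ 0 := Real.sin_nonpos_of_nonpos_of_neg_pi_le (not_lt.mp hneg)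
    (by linarith [Real.pi_pos])
  rw [hs] at this
  have : 0 < y / M := by positivity
  linarith

/-- Mean value bound for the sine. -/
theorem pek_mvt (a b : ℝ) (ha : 0 < a) (hb : b < Real.pi / 2) (hab : a < b) :
    Real.cos b * (b - a) ≤ Real.sin b - Real.sin a := by
  obtain ⟨c, hc, h⟩ := exists_deriv_eq_slope Real.sin hab Real.continuous_sin.continuousOn
    Real.differentiable_sin.differentiableOn
  rw [Real.deriv_sin, eq_div_iff (by linarith)] at h
  rw [← h]
  have := Real.cos_le_cos_of_nonneg_of_le_pi (x := c) (y := b) (by linarith [hc.1])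
    (by linarith [Real.pi_pos]) hc.2.le
  exact mul_le_mul_of_nonneg_right this (by linarith)

/-- For every `α ∈ (1/3, 1)` and all `n₁ > 1`, `d > 0`, there are `C > 0`, `k₀ > 0` such that
for every `k ≥ k₀` and every `j ∈ {1,…,N − ⌊N^α⌋ − 1}`:
`|σ_{j+1} − σ_j − π| ≤ C·N^{(1−3α)/2}`. -/
theorem mode_spacing_estimate (α n₁ d : ℝ)
    (hα : α ∈ Set.Ioo (1 / 3 : ℝ) 1) (hn : 1 < n₁) (hd : 0 < d) :
    ∃ C > (0 : ℝ), ∃ k₀ > (0 : ℝ), ∀ k ≥ k₀, ∀ σ : ℕ → ℝ, IsModeFamily n₁ d k σ →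
      ∀ j : ℕ, 1 ≤ j → j ≤ pekN n₁ d k - Nat.floor ((pekN n₁ d k : ℝ) ^ α) - 1 →
        |σ (j + 1) - σ j - Real.pi| ≤ C * (pekN n₁ d k : ℝ) ^ ((1 - 3 * α) / 2) := by
  obtain ⟨hα1, hα2⟩ := hα
  refine ⟨4, by norm_num, 1, by norm_num, ?_⟩
  intro k _ σ hσ j hj hjN
  set M := pekM n₁ d k with hMdef
  set N := pekN n₁ d k with hNdef
  set F := Nat.floor ((N : ℝ) ^ α) with hF
  have hpi := Real.pi_pos
  have hN : j + 1 + F ≤ N := by omega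
  obtain ⟨⟨s1, s2⟩, ⟨s3, s4⟩, s5⟩ := hσ j hj (by omega)
  obtain ⟨⟨t1, t2⟩, ⟨t3, t4⟩, t5⟩ := hσ (j + 1) (by omega) (by omega)
  rw [← hMdef] at s4 s5 t4 t5
  have hM : 0 < M := s3.trans s4
  obtain ⟨p1, p2, p3, p4⟩ := pek_phase M (σ j) j s3 s4 s1 s2 s5
  obtain ⟨q1, q2, q3, q4⟩ := pek_phase M (σ (j + 1)) (j + 1) t3 t4 t1 t2 t5
  set s := σ j
  set t := σ (j + 1)
  set a := (j : ℝ) * Real.pi - s with ha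
  set b := ((j + 1 : ℕ) : ℝ) * Real.pi - t with hb
  have hst : s < t := by push_cast at t1; linarith
  have hN1 : (1 : ℝ) ≤ N := by exact_mod_cast (by omega : 1 ≤ N)
  have hN0 : (0 : ℝ) < N := by linarith
  have hab : a < b := by
    by_contra hba
    have h := Real.sin_le_sin_of_le_of_le_pi_div_two (x := b) (y := a) (by linarith) p4.le
      (not_lt.mp hba)
    rw [p1, q1] at h
    have : s / M < t / M := by gcongr
    linarith
  have hdiff : t - s - Real.pi = -(b - a) := by rw [ha, hb]; push_cast; ring
  rw [hdiff, abs_neg, abs_of_pos (by linarith)]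
  have hmvt := pek_mvt a b p3 q4 hab
  have hts : t - s ≤ Real.pi := by linarith
  have hMN : (N : ℝ) * Real.pi ≤ M := by
    have := Nat.floor_le (a := M / Real.pi) (by positivity)
    rw [le_div_iff₀ hpi] at this
    exact this
  have hMN2 : M ≤ 2 * N * Real.pi := by
    have h := Nat.lt_floor_add_one (M / Real.pi)
    rw [div_lt_iff₀ hpi] at h
    have h' : M < ((N : ℝ) + 1) * Real.pi := h
    have h2 := mul_le_mul_of_nonneg_right hN1 hpi.le
    linarith
  have hF1 : (N : ℝ) ^ α ≤ 2 * F := by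
    have h1 : (1 : ℝ) ≤ (N : ℝ) ^ α := Real.one_le_rpow hN1 (by linarith)
    have h2 : (1 : ℝ) ≤ F := by exact_mod_cast (Nat.one_le_floor_iff _).mpr h1
    have h3 := Nat.lt_floor_add_one ((N : ℝ) ^ α)
    rw [← hF] at h3
    linarith
  have htM : t ≤ M - F * Real.pi := by
    have h : ((j + 1 : ℕ) : ℝ) + F ≤ N := by exact_mod_cast hN
    have h' := mul_le_mul_of_nonneg_right h hpi.le
    linarith
  have hcosb : (N : ℝ) ^ ((α - 1) / 2) / 2 ≤ Real.cos b := by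
    rw [q2, le_div_iff₀ hM]
    apply Real.le_sqrt_of_sq_le
    have e : ((N : ℝ) ^ ((α - 1) / 2)) ^ 2 = (N : ℝ) ^ α / N := by
      rw [← Real.rpow_natCast, ← Real.rpow_mul hN0.le, ← Real.rpow_sub_one hN0.ne']
      congr 1
      push_cast
      ring
    have e2 : ((N : ℝ) ^ ((α - 1) / 2) / 2 * M) ^ 2 = (N : ℝ) ^ α / N * M ^ 2 / 4 := by
      rw [← e]; ring
    rw [e2]
    have e3 : (N : ℝ) ^ α / N * M ^ 2 / 4 ≤ F * Real.pi * M := by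
      rw [div_mul_eq_mul_div, div_div, div_le_iff₀ (by positivity)]
      calc (N : ℝ) ^ α * M ^ 2 = (N : ℝ) ^ α * M * M := by ring
        _ ≤ (2 * F) * M * (2 * N * Real.pi) := by gcongr
        _ = F * Real.pi * M * (N * 4) := by ring
    have e4 : F * Real.pi * M ≤ (M - t) * M := by
      apply mul_le_mul_of_nonneg_right _ hM.le
      linarith
    have e5 : 0 ≤ t * (M - t) := mul_nonneg t3.le (by linarith)
    have e6 : M ^ 2 - t ^ 2 = (M - t) * M + t * (M - t) := by ring
    linarith
  have hX : (N : ℝ) ^ ((α - 1) / 2) / 2 * (b - a) ≤ 1 / N := by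
    calc (N : ℝ) ^ ((α - 1) / 2) / 2 * (b - a) ≤ Real.cos b * (b - a) := by
          apply mul_le_mul_of_nonneg_right hcosb; linarith
      _ ≤ Real.sin b - Real.sin a := hmvt
      _ = (t - s) / M := by rw [p1, q1]; ring
      _ ≤ 1 / N := by
          rw [div_le_div_iff₀ hM hN0]
          have h := mul_le_mul_of_nonneg_right hts hN0.le
          linarith
  have hpw : 0 < (N : ℝ) ^ ((α - 1) / 2) := by positivity
  have key : 1 / (N : ℝ) ≤ (N : ℝ) ^ ((α - 1) / 2) / 2 * (4 * (N : ℝ) ^ ((1 - 3 * α) / 2)) := by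
    have e : (N : ℝ) ^ ((α - 1) / 2) * (N : ℝ) ^ ((1 - 3 * α) / 2) = (N : ℝ) ^ (-α) := by
      rw [← Real.rpow_add hN0]; congr 1; ring
    have e1 : (N : ℝ) ^ (-1 : ℝ) ≤ (N : ℝ) ^ (-α) :=
      Real.rpow_le_rpow_of_exponent_le hN1 (by linarith)
    rw [Real.rpow_neg_one] at e1
    have e0 : 0 < (N : ℝ) ^ (-α) := by positivity
    have e2 : (N : ℝ) ^ ((α - 1) / 2) / 2 * (4 * (N : ℝ) ^ ((1 - 3 * α) / 2))
        = 2 * (N : ℝ) ^ (-α) := by rw [← e]; ring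
    rw [one_div, e2]
    linarith
  exact le_of_mul_le_mul_left (hX.trans key) (by positivity)
end

section
/- For every α ∈ [0, 1) and all reals n₁ > 1, d > 0, there exist constants C > 0 and k₀ > 0 such that for every k ≥ k₀ and every j ∈ {1, …, ⌊N^α⌋} one has |σ_j − jπ| ≤ C·N^{α−1}. -/
open Real Filter MeasureTheory

/-- For every `α ∈ [0, 1)` and all `n₁ > 1`, `d > 0`, there are `C > 0`, `k₀ > 0` such that
for every `k ≥ k₀` and every `j ∈ {1,…,⌊N^α⌋}`: `|σ_j − jπ| ≤ C·N^{α−1}`. -/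
theorem low_mode_approximation (α n₁ d : ℝ)
    (hα : α ∈ Set.Ico (0 : ℝ) 1) (hn : 1 < n₁) (hd : 0 < d) :
    ∃ C > (0 : ℝ), ∃ k₀ > (0 : ℝ), ∀ k ≥ k₀, ∀ σ : ℕ → ℝ, IsModeFamily n₁ d k σ →
      ∀ j : ℕ, 1 ≤ j → j ≤ Nat.floor ((pekN n₁ d k : ℝ) ^ α) →
        |σ j - (j : ℝ) * Real.pi| ≤ C * (pekN n₁ d k : ℝ) ^ (α - 1) := by
  have hθ : 0 < pekTheta n₁ := by
    unfold pekTheta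
    apply Real.sqrt_pos.mpr
    have h1 : 1 < n₁ ^ 2 := by nlinarith
    have h2 : 1 / n₁ ^ 2 < 1 := by
      rw [div_lt_one (by linarith)]
      exact h1
    linarith
  have hc : 0 < n₁ * d * pekTheta n₁ := by
    have : 0 < n₁ := by linarith
    positivity
  have hπ := Real.pi_pos
  refine ⟨Real.pi, hπ, Real.pi / (n₁ * d * pekTheta n₁), by positivity, ?_⟩
  intro k hk σ hσ j hj hjN
  have hM : Real.pi ≤ pekM n₁ d k := by
    have h := (div_le_iff₀ hc).mp hk
    unfold pekM
    linarith
  have hMpos : 0 < pekM n₁ d k := by linarith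
  have hN1 : 1 ≤ pekN n₁ d k := by
    unfold pekN
    apply Nat.le_floor
    rw [le_div_iff₀ hπ]
    simpa using hM
  have hNM : (pekN n₁ d k : ℝ) * Real.pi ≤ pekM n₁ d k := by
    have h := Nat.floor_le (a := pekM n₁ d k / Real.pi) (by positivity)
    rw [le_div_iff₀ hπ] at h
    exact h
  have hN1' : (1 : ℝ) ≤ (pekN n₁ d k : ℝ) := by exact_mod_cast hN1
  have hjα : (j : ℝ) ≤ (pekN n₁ d k : ℝ) ^ α := by
    have h := Nat.floor_le (a := (pekN n₁ d k : ℝ) ^ α) (by positivity)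
    exact le_trans (by exact_mod_cast hjN) h
  have hjN' : j ≤ pekN n₁ d k := by
    have h : (pekN n₁ d k : ℝ) ^ α ≤ (pekN n₁ d k : ℝ) ^ (1 : ℝ) :=
      Real.rpow_le_rpow_of_exponent_le hN1' hα.2.le
    rw [Real.rpow_one] at h
    exact_mod_cast hjα.trans h
  obtain ⟨⟨hl, hu⟩, ⟨h0, hlt⟩, htan⟩ := hσ j hj hjN'
  have hj1 : (1 : ℝ) ≤ (j : ℝ) := by exact_mod_cast hj
  rw [Real.rpow_sub_one (by linarith)]
  generalize (pekN n₁ d k : ℝ) ^ α = P at *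
  generalize (pekN n₁ d k : ℝ) = N at *
  generalize pekM n₁ d k = M at *
  generalize σ j = s at *
  have htan' : Real.tan (s - j * Real.pi) = - s / Real.sqrt (M ^ 2 - s ^ 2) := by
    rw [Real.tan_sub_nat_mul_pi, htan]
  set t := s - j * Real.pi with ht
  have ht1 : |t| ≤ Real.pi / 2 := by
    rw [abs_le]
    constructor <;> linarith
  have hcos : 0 < Real.cos t := by
    apply Real.cos_pos_of_mem_Ioo
    constructor <;> linarith
  have hD : 0 < M ^ 2 - s ^ 2 := by nlinarith
  have hsq := Real.sq_sqrt hD.le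
  have hR : 0 < Real.sqrt (M ^ 2 - s ^ 2) := Real.sqrt_pos.mpr hD
  rw [Real.tan_eq_sin_div_cos, div_eq_div_iff hcos.ne' hR.ne'] at htan'
  have hsin : (Real.sin t * M) ^ 2 = s ^ 2 := by
    have h2 : (Real.sin t) ^ 2 * (M ^ 2 - s ^ 2) = s ^ 2 * (Real.cos t) ^ 2 := by
      rw [← hsq, ← mul_pow, htan']
      ring
    have h3 := Real.sin_sq_add_cos_sq t
    linear_combination h2 + s ^ 2 * h3
  have habs : |Real.sin t| * M = s := by
    have h := (sq_eq_sq_iff_abs_eq_abs _ _).mp hsin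
    rwa [abs_mul, abs_of_pos hMpos, abs_of_pos h0] at h
  have hJ := Real.mul_abs_le_abs_sin ht1
  have hJ' : |t| ≤ Real.pi / 2 * |Real.sin t| := by
    have : |t| = Real.pi / 2 * (2 / Real.pi * |t|) := by field_simp
    rw [this]
    gcongr
  have hsN : |Real.sin t| * N ≤ 3 / 2 * j := by
    have h1 : |Real.sin t| * (N * Real.pi) ≤ s :=
      (mul_le_mul_of_nonneg_left hNM (abs_nonneg _)).trans habs.le
    have h2 : |Real.sin t| * N * Real.pi ≤ 3 / 2 * j * Real.pi := by nlinarith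
    exact le_of_mul_le_mul_right h2 hπ
  rw [← mul_div_assoc, le_div_iff₀ (by linarith)]
  calc |t| * N ≤ Real.pi / 2 * |Real.sin t| * N := by gcongr
    _ = Real.pi / 2 * (|Real.sin t| * N) := by ring
    _ ≤ Real.pi / 2 * (2 * P) := by
        apply mul_le_mul_of_nonneg_left _ (by positivity)
        linarith
    _ = Real.pi * P := by ring
end

section
/- For every α ∈ (1/3, 1) and all reals n₁ > 1, d > 0, there exist constants C > 0 and k₀ > 0 such that for every k ≥ k₀ and every j ∈ {1, …, N − ⌊N^α⌋} one has |A_j² − 2/d| ≤ C·N^{α−1}. -/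
open Real Filter MeasureTheory

/-- For every `α ∈ (1/3, 1)` and all `n₁ > 1`, `d > 0`, there are `C > 0`, `k₀ > 0` such that
for every `k ≥ k₀` and every `j ∈ {1,…,N − ⌊N^α⌋}`: `|A_j² − 2/d| ≤ C·N^{α−1}`. -/
theorem normalization_constant_estimate (α n₁ d : ℝ)
    (hα : α ∈ Set.Ioo (1 / 3 : ℝ) 1) (hn : 1 < n₁) (hd : 0 < d) :
    ∃ C > (0 : ℝ), ∃ k₀ > (0 : ℝ), ∀ k ≥ k₀, ∀ σ : ℕ → ℝ, IsModeFamily n₁ d k σ →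
      ∀ j : ℕ, 1 ≤ j → j ≤ pekN n₁ d k - Nat.floor ((pekN n₁ d k : ℝ) ^ α) →
        |(pekA n₁ d k (σ j)) ^ 2 - 2 / d| ≤ C * (pekN n₁ d k : ℝ) ^ (α - 1) := by
  obtain ⟨hα1, hα2⟩ := hα
  refine ⟨2 / d, by positivity, 1, one_pos, ?_⟩
  intro k _ σ hσ j hj1 hj2
  obtain ⟨⟨-, hs1⟩, ⟨hs0, hsM⟩, htan⟩ := hσ j hj1 (le_trans hj2 (Nat.sub_le _ _))
  have hNM : (pekN n₁ d k : ℝ) ≤ pekM n₁ d k / Real.pi := by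
    apply Nat.floor_le
    have : 0 < pekM n₁ d k := hs0.trans hsM
    positivity
  unfold pekA pekZeta
  set M := pekM n₁ d k with hM
  set N := pekN n₁ d k with hN
  set y := σ j with hy
  have hN1 : 1 ≤ N := by omega
  have hNR : (1 : ℝ) ≤ N := by exact_mod_cast hN1
  set F := Nat.floor ((N : ℝ) ^ α) with hF
  have hNa : (1 : ℝ) ≤ (N : ℝ) ^ α := Real.one_le_rpow hNR (by linarith)
  have hF1 : 1 ≤ F := Nat.le_floor (by simpa using hNa)
  have hF1' : (1 : ℝ) ≤ F := by exact_mod_cast hF1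
  have hF2 : (N : ℝ) ^ α < F + 1 := Nat.lt_floor_add_one _
  have hjF : (j : ℝ) + F ≤ N := by
    have : j + F ≤ N := by omega
    exact_mod_cast this
  have hpi : (3 : ℝ) < Real.pi := Real.pi_gt_three
  rw [le_div_iff₀ Real.pi_pos] at hNM
  have hMpos : 0 < M := hs0.trans hsM
  have hgap : 3 / 4 * (N : ℝ) ^ α ≤ M - y := by
    have h1 : ((j : ℝ) + F) * Real.pi ≤ N * Real.pi :=
      mul_le_mul_of_nonneg_right hjF Real.pi_pos.le
    have h2 : 3 * ((F : ℝ) - 1 / 2) ≤ Real.pi * ((F : ℝ) - 1 / 2) :=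
      mul_le_mul_of_nonneg_right hpi.le (by linarith)
    nlinarith
  have hM3 : 3 * (N : ℝ) ≤ M := by nlinarith
  have hz2pos : 0 < M ^ 2 - y ^ 2 := by nlinarith
  have hz2 : (N : ℝ) * (N : ℝ) ^ α ≤ M ^ 2 - y ^ 2 := by
    have h3 : (3 * (N : ℝ)) * (3 / 4 * (N : ℝ) ^ α) ≤ (M + y) * (M - y) :=
      mul_le_mul (by linarith) hgap (by positivity) (by linarith)
    have h4 : 0 ≤ (N : ℝ) * (N : ℝ) ^ α := by positivity
    nlinarith
  set z := Real.sqrt (M ^ 2 - y ^ 2) with hz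
  have hzpos : 0 < z := Real.sqrt_pos.mpr hz2pos
  have hzsq : z ^ 2 = M ^ 2 - y ^ 2 := Real.sq_sqrt hz2pos.le
  have hcos : Real.cos y ≠ 0 := by
    intro h
    rw [Real.tan_eq_sin_div_cos, h, div_zero] at htan
    have : - y / z < 0 := div_neg_of_neg_of_pos (by linarith) hzpos
    linarith
  have hsz : Real.sin y * z = - y * Real.cos y := by
    rw [Real.tan_eq_sin_div_cos, div_eq_div_iff hcos hzpos.ne'] at htan
    exact htan
  have hD : 1 + Real.sin y ^ 2 / z - Real.sin (2 * y) / (2 * y) = 1 + 1 / z := by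
    have h1 : Real.sin (2 * y) / (2 * y) = - Real.cos y ^ 2 / z := by
      rw [Real.sin_two_mul, div_eq_div_iff (by positivity) hzpos.ne']
      linear_combination 2 * Real.cos y * hsz
    rw [h1, ← Real.sin_sq_add_cos_sq y]
    ring
  have hzN : (N : ℝ) ^ (1 - α) ≤ z := by
    apply Real.le_sqrt_of_sq_le
    refine le_trans ?_ hz2
    have hN0 : (0 : ℝ) < N := by linarith
    rw [← Real.rpow_natCast, ← Real.rpow_mul hN0.le]
    nth_rewrite 2 [← Real.rpow_one (N : ℝ)]
    rw [← Real.rpow_add hN0]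
    apply Real.rpow_le_rpow_of_exponent_le hNR
    push_cast
    linarith
  have hinv : 1 / z ≤ (N : ℝ) ^ (α - 1) := by
    have : (N : ℝ) ^ (α - 1) = 1 / (N : ℝ) ^ (1 - α) := by
      rw [one_div, ← Real.rpow_neg (by linarith)]
      congr 1
      ring
    rw [this]
    exact one_div_le_one_div_of_le (by positivity) hzN
  rw [hD, Real.sq_sqrt (by positivity)]
  have heq : 2 / d / (1 + 1 / z) - 2 / d = - (2 / d * (1 / (z + 1))) := by
    field_simp
    ring
  rw [heq, abs_neg, abs_of_pos (by positivity)]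
  apply mul_le_mul_of_nonneg_left _ (by positivity)
  exact le_trans (one_div_le_one_div_of_le hzpos (by linarith)) hinv
end

section
/- Fix reals n₁ > 1, d > 0, k > 0, and set θ = √(1 − 1/n₁²) and M = n₁·k·d·θ. Suppose σ ∈ (0, M) satisfies tan(σ) = −σ/√(M² − σ²). Set ζ = √(M² − σ²) and β = √(n₁²k² − σ²/d²). Then: (i) k < β < n₁k; (ii) the function φ : [0, ∞) → ℝ defined by φ(x) = sin(σx/d) for 0 ≤ x ≤ d and φ(x) = sin(σ)·e^{−ζ(x−d)/d} for x ≥ d is continuously differentiable on [0, ∞), square-integrable on (0, ∞), satisfies φ(0) = 0, and satisfies the eigenvalue equation φ''(x) + k²·n(x)²·φ(x) = β²·φ(x) for every x ∈ (0, d) ∪ (d, ∞), where n(x) = n₁ for 0 ≤ x < d and n(x) = 1 for x ≥ d. -/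
open Real MeasureTheory

/-- If `σ ∈ (0, M)` solves the dispersion relation `tan σ = −σ/√(M²−σ²)`, then with
`ζ = √(M²−σ²)` and `β = √(n₁²k² − σ²/d²)` one has `k < β < n₁k`, and the mode profile
`φ` (equal to `sin(σx/d)` on `[0,d]` and `sin(σ)·e^{−ζ(x−d)/d}` beyond) is `C¹` on `[0,∞)`,
square integrable, vanishes at `0`, and satisfies `φ'' + k²n(x)²φ = β²φ` away from `x = d`. -/
theorem pekeris_eigenfunction (n₁ d k : ℝ) (hn : 1 < n₁) (hd : 0 < d) (hk : 0 < k)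
    (σ : ℝ) (hσ₀ : 0 < σ) (hσM : σ < pekM n₁ d k)
    (hdisp : Real.tan σ = - σ / Real.sqrt ((pekM n₁ d k) ^ 2 - σ ^ 2)) :
    let ζ : ℝ := Real.sqrt ((pekM n₁ d k) ^ 2 - σ ^ 2)
    let β : ℝ := Real.sqrt (n₁ ^ 2 * k ^ 2 - σ ^ 2 / d ^ 2)
    let φ : ℝ → ℝ := fun x =>
      if x ≤ d then Real.sin (σ * x / d) else Real.sin σ * Real.exp (- ζ * (x - d) / d)
    (k < β ∧ β < n₁ * k) ∧
    ContDiffOn ℝ 1 φ (Set.Ici 0) ∧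
    IntegrableOn (fun x => (φ x) ^ 2) (Set.Ioi 0) ∧
    φ 0 = 0 ∧
    (∀ x ∈ Set.Ioo 0 d ∪ Set.Ioi d,
      deriv (deriv φ) x + k ^ 2 * (if x < d then n₁ else 1) ^ 2 * φ x = β ^ 2 * φ x) := by
  intro ζ β φ
  have hn0 : 0 < n₁ := by linarith
  have hM2 : (pekM n₁ d k) ^ 2 = k ^ 2 * d ^ 2 * (n₁ ^ 2 - 1) := by
    unfold pekM pekTheta
    have h1 : 0 ≤ 1 - 1 / n₁ ^ 2 := by
      rw [sub_nonneg, div_le_one (by positivity)]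
      nlinarith
    rw [mul_pow, Real.sq_sqrt h1]
    field_simp
  have hpos : 0 < (pekM n₁ d k) ^ 2 - σ ^ 2 := by nlinarith
  have hζ : 0 < ζ := Real.sqrt_pos.mpr hpos
  have hζ2 : ζ ^ 2 = k ^ 2 * d ^ 2 * (n₁ ^ 2 - 1) - σ ^ 2 := by
    rw [← hM2]; exact Real.sq_sqrt hpos.le
  have hβ : n₁ ^ 2 * k ^ 2 - σ ^ 2 / d ^ 2 = k ^ 2 + ζ ^ 2 / d ^ 2 := by
    rw [hζ2]; field_simp; ring
  have hβ2 : β ^ 2 = n₁ ^ 2 * k ^ 2 - σ ^ 2 / d ^ 2 := by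
    apply Real.sq_sqrt
    rw [hβ]; positivity
  have hdisp' : Real.tan σ = -σ / ζ := hdisp
  have hcos : Real.cos σ ≠ 0 := by
    intro h
    rw [Real.tan_eq_sin_div_cos, h, div_zero, eq_comm, div_eq_zero_iff] at hdisp'
    rcases hdisp' with h | h <;> linarith
  have hmatch : Real.sin σ * ζ = -σ * Real.cos σ := by
    rw [Real.tan_eq_sin_div_cos, div_eq_div_iff hcos hζ.ne'] at hdisp'
    exact hdisp'
  have hA : ∀ x, HasDerivAt (fun x => Real.sin (σ * x / d)) (σ / d * Real.cos (σ * x / d)) x := by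
    intro x
    have h := (((hasDerivAt_id' x).const_mul σ).div_const d).sin
    exact h.congr_deriv (by ring)
  have hA' : ∀ x, HasDerivAt (fun x => σ / d * Real.cos (σ * x / d))
      (-(σ ^ 2 / d ^ 2) * Real.sin (σ * x / d)) x := by
    intro x
    have h := ((((hasDerivAt_id' x).const_mul σ).div_const d).cos).const_mul (σ / d)
    exact h.congr_deriv (by ring)
  have hB : ∀ c x, HasDerivAt (fun x => c * Real.exp (-ζ * (x - d) / d))
      (c * (-ζ / d) * Real.exp (-ζ * (x - d) / d)) x := by
    intro c x
    have h := ((((((hasDerivAt_id' x).sub_const d).const_mul (-ζ)).div_const d).exp).const_mul c)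
    exact h.congr_deriv (by ring)
  set g : ℝ → ℝ := fun x => if x ≤ d then σ / d * Real.cos (σ * x / d)
    else Real.sin σ * (-ζ / d) * Real.exp (-ζ * (x - d) / d) with hg
  have hgd : σ / d * Real.cos (σ * d / d) = Real.sin σ * (-ζ / d) * Real.exp (-ζ * (d - d) / d) := by
    rw [mul_div_cancel_right₀ _ hd.ne']
    simp only [sub_self, mul_zero, zero_div, Real.exp_zero, mul_one]
    have : Real.sin σ * (-ζ / d) = - (Real.sin σ * ζ) / d := by ring
    rw [this, hmatch]; ring
  have hφlt : ∀ x ≤ d, φ x = Real.sin (σ * x / d) := fun x hx => if_pos hx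
  have hφge : ∀ x, d ≤ x → φ x = Real.sin σ * Real.exp (-ζ * (x - d) / d) := by
    intro x hx
    rcases hx.eq_or_lt with h | h
    · subst h
      rw [hφlt _ le_rfl, mul_div_cancel_right₀ _ hd.ne']
      simp
    · exact if_neg (not_le.mpr h)
  have hglt : ∀ x ≤ d, g x = σ / d * Real.cos (σ * x / d) := fun x hx => if_pos hx
  have hgge : ∀ x, d ≤ x → g x = Real.sin σ * (-ζ / d) * Real.exp (-ζ * (x - d) / d) := by
    intro x hx
    rcases hx.eq_or_lt with h | h
    · rw [← h, hglt _ le_rfl, hgd]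
    · exact if_neg (not_le.mpr h)
  have hder : ∀ x, HasDerivAt φ (g x) x := by
    intro x
    rcases lt_trichotomy x d with h | h | h
    · rw [hglt x h.le]
      refine (hA x).congr_of_eventuallyEq ?_
      filter_upwards [Iio_mem_nhds h] with y hy using hφlt y (le_of_lt hy)
    · subst h
      rw [← hasDerivWithinAt_univ, ← Set.Iic_union_Ici (a := x)]
      apply HasDerivWithinAt.union
      · rw [hglt x le_rfl]
        exact (hA x).hasDerivWithinAt.congr (fun y hy => hφlt y hy) (hφlt x le_rfl)
      · rw [hgge x le_rfl]
        exact (hB _ x).hasDerivWithinAt.congr (fun y hy => hφge y hy) (hφge x le_rfl)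
    · rw [hgge x h.le]
      refine (hB _ x).congr_of_eventuallyEq ?_
      filter_upwards [Ioi_mem_nhds h] with y hy using hφge y (le_of_lt hy)
  have hdφ : deriv φ = g := funext fun x => (hder x).deriv
  have hgc : Continuous g := by
    apply Continuous.if_le
    · fun_prop
    · fun_prop
    · fun_prop
    · fun_prop
    · intro x hx
      rw [hx]; exact hgd
  have hφd : Differentiable ℝ φ := fun x => (hder x).differentiableAt
  refine ⟨⟨?_, ?_⟩, ?_, ?_, ?_, ?_⟩
  · apply Real.lt_sqrt_of_sq_lt
    rw [hβ]
    have : 0 < ζ ^ 2 / d ^ 2 := by positivity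
    linarith
  · rw [Real.sqrt_lt' (by positivity)]
    have : 0 < σ ^ 2 / d ^ 2 := by positivity
    nlinarith
  · apply ContDiff.contDiffOn
    rw [contDiff_one_iff_deriv]
    exact ⟨hφd, hdφ ▸ hgc⟩
  · rw [← Set.Ioc_union_Ioi_eq_Ioi hd.le]
    apply IntegrableOn.union
    · exact ((hφd.continuous.pow 2).integrableOn_Icc).mono_set Set.Ioc_subset_Icc_self
    · have hb : 0 < 2 * ζ / d := by positivity
      have h := (exp_neg_integrableOn_Ioi d hb).const_mul ((Real.sin σ) ^ 2 * Real.exp (2 * ζ))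
      refine IntegrableOn.congr_fun h ?_ measurableSet_Ioi
      intro x hx
      simp only
      rw [hφge x (le_of_lt hx), mul_pow, mul_assoc, ← Real.exp_add, ← Real.exp_nat_mul]
      congr 2
      push_cast
      field_simp
      ring
  · rw [hφlt 0 hd.le]; simp
  · rintro x (hx | hx)
    · have h2 : deriv g x = -(σ ^ 2 / d ^ 2) * Real.sin (σ * x / d) := by
        refine ((hA' x).congr_of_eventuallyEq ?_).deriv
        filter_upwards [Iio_mem_nhds hx.2] with y hy using hglt y (le_of_lt hy)
      rw [hdφ, h2, hβ2, if_pos hx.2, hφlt x hx.2.le]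
      ring
    · have hx' : d < x := hx
      have h2 : deriv g x = Real.sin σ * (-ζ / d) * (-ζ / d) * Real.exp (-ζ * (x - d) / d) := by
        refine ((hB _ x).congr_of_eventuallyEq ?_).deriv
        filter_upwards [Ioi_mem_nhds hx'] with y hy using hgge y (le_of_lt hy)
      rw [hdφ, h2, hβ2, hβ, if_neg (not_lt.mpr hx'.le), hφge x hx'.le]
      ring
end

section
/- Fix reals n₁ > 1, d > 0, k > 0, and set θ = √(1 − 1/n₁²), M = n₁·k·d·θ, N = ⌊M/π⌋. Then the family (φ_j)_{j=1}^{N} is orthonormal in L²(0, ∞): for all j, l ∈ {1, …, N}, ∫₀^∞ φ_j(x)·φ_l(x) dx = 1 if j = l and 0 if j ≠ l. -/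
open Real Filter MeasureTheory

theorem pek_tail (d w : ℝ) (hd : 0 < d) (hw : 0 < w) :
    IntegrableOn (fun x => Real.exp (-w * (x - d) / d)) (Set.Ioi d) ∧
    ∫ x in Set.Ioi d, Real.exp (-w * (x - d) / d) = d / w := by
  have e : (fun x => Real.exp (-w * (x - d) / d)) =
      fun x => Real.exp w * Real.exp ((-w / d) * x) := by
    funext x
    rw [← Real.exp_add]
    congr 1
    field_simp
    ring
  have hneg : -w / d < 0 := div_neg_of_neg_of_pos (by linarith) hd
  rw [e]
  refine ⟨(integrableOn_exp_mul_Ioi hneg d).const_mul _, ?_⟩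
  rw [integral_const_mul, integral_exp_mul_Ioi hneg]
  have : -w / d * d = -w := by field_simp
  rw [this, Real.exp_neg]
  have := Real.exp_pos w
  field_simp

theorem pek_split (n₁ d k a b : ℝ) (hd : 0 < d)
    (hw : 0 < pekZeta n₁ d k a + pekZeta n₁ d k b) :
    (∫ x in Set.Ioi (0 : ℝ), pekPhi n₁ d k a x * pekPhi n₁ d k b x) =
      pekA n₁ d k a * pekA n₁ d k b *
        ((∫ x in (0 : ℝ)..d, Real.sin (a * x / d) * Real.sin (b * x / d)) +
          Real.sin a * Real.sin b * (d / (pekZeta n₁ d k a + pekZeta n₁ d k b))) := by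
  obtain ⟨t1, t2⟩ := pek_tail d _ hd hw
  have e1 : Set.EqOn (fun x => pekPhi n₁ d k a x * pekPhi n₁ d k b x)
      (fun x => pekA n₁ d k a * pekA n₁ d k b *
        (Real.sin (a * x / d) * Real.sin (b * x / d))) (Set.Ioc 0 d) := by
    intro x hx
    simp only [pekPhi, if_pos hx.2]
    ring
  have e2 : Set.EqOn (fun x => pekPhi n₁ d k a x * pekPhi n₁ d k b x)
      (fun x => pekA n₁ d k a * pekA n₁ d k b * (Real.sin a * Real.sin b) *
        Real.exp (-(pekZeta n₁ d k a + pekZeta n₁ d k b) * (x - d) / d)) (Set.Ioi d) := by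
    intro x hx
    have hx' : ¬ x ≤ d := not_le.mpr hx
    have : Real.exp (-(pekZeta n₁ d k a + pekZeta n₁ d k b) * (x - d) / d) =
      Real.exp (-pekZeta n₁ d k a * (x - d) / d) *
        Real.exp (-pekZeta n₁ d k b * (x - d) / d) := by
      rw [← Real.exp_add]
      congr 1
      ring
    simp only [pekPhi, if_neg hx', this]
    ring
  have i1 : IntegrableOn (fun x => pekPhi n₁ d k a x * pekPhi n₁ d k b x) (Set.Ioc 0 d) := by
    rw [integrableOn_congr_fun e1 measurableSet_Ioc]
    exact (Continuous.integrableOn_Icc (by fun_prop)).mono_set Set.Ioc_subset_Icc_self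
  have i2 : IntegrableOn (fun x => pekPhi n₁ d k a x * pekPhi n₁ d k b x) (Set.Ioi d) := by
    rw [integrableOn_congr_fun e2 measurableSet_Ioi]
    exact t1.const_mul _
  rw [← Set.Ioc_union_Ioi_eq_Ioi hd.le,
    setIntegral_union (Set.Ioc_disjoint_Ioi le_rfl) measurableSet_Ioi i1 i2,
    setIntegral_congr_fun measurableSet_Ioc e1, setIntegral_congr_fun measurableSet_Ioi e2,
    integral_const_mul, integral_const_mul, t2, intervalIntegral.integral_of_le hd.le]
  ring

theorem pek_int_ne (d a b : ℝ) (hd : 0 < d) (hab : a ^ 2 - b ^ 2 ≠ 0) :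
    (∫ x in (0 : ℝ)..d, Real.sin (a * x / d) * Real.sin (b * x / d)) =
      d * (b * Real.sin a * Real.cos b - a * Real.cos a * Real.sin b) / (a ^ 2 - b ^ 2) := by
  have hlin : ∀ c x : ℝ, HasDerivAt (fun x : ℝ => c * x / d) (c / d) x := by
    intro c x
    simpa using ((hasDerivAt_id x).const_mul c).div_const d
  rw [intervalIntegral.integral_eq_sub_of_hasDerivAt
    (f := fun x => d * (b * (Real.sin (a * x / d) * Real.cos (b * x / d)) -
      a * (Real.cos (a * x / d) * Real.sin (b * x / d))) / (a ^ 2 - b ^ 2))]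
  · simp [hd.ne']
    ring
  · intro x _
    have h := ((((((hlin a x).sin).mul ((hlin b x).cos)).const_mul b).sub
      ((((hlin a x).cos).mul ((hlin b x).sin)).const_mul a)).const_mul d).div_const (a ^ 2 - b ^ 2)
    refine h.congr_deriv ?_
    field_simp
    ring
  · exact Continuous.intervalIntegrable (by fun_prop) _ _

theorem pek_int_eq (d a : ℝ) (hd : 0 < d) (ha : 0 < a) :
    (∫ x in (0 : ℝ)..d, Real.sin (a * x / d) * Real.sin (a * x / d)) =
      d / 2 * (1 - Real.sin (2 * a) / (2 * a)) := by
  have hlin : ∀ c x : ℝ, HasDerivAt (fun x : ℝ => c * x / d) (c / d) x := by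
    intro c x
    simpa using ((hasDerivAt_id x).const_mul c).div_const d
  rw [intervalIntegral.integral_eq_sub_of_hasDerivAt
    (f := fun x => x / 2 - d / (2 * a) * (Real.sin (a * x / d) * Real.cos (a * x / d)))]
  · rw [Real.sin_two_mul]
    simp [hd.ne']
    field_simp
  · intro x _
    have h := ((hasDerivAt_id x).div_const 2).sub
      (((hlin a x).sin.mul (hlin a x).cos).const_mul (d / (2 * a)))
    refine h.congr_deriv ?_
    have := Real.sin_sq_add_cos_sq (a * x / d)
    field_simp
    linear_combination -this
  · exact Continuous.intervalIntegrable (by fun_prop) _ _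

theorem pek_rel (n₁ d k a : ℝ) (ha : a ∈ Set.Ioo 0 (pekM n₁ d k))
    (ht : Real.tan a = - a / Real.sqrt ((pekM n₁ d k) ^ 2 - a ^ 2)) :
    0 < pekZeta n₁ d k a ∧ pekZeta n₁ d k a ^ 2 = pekM n₁ d k ^ 2 - a ^ 2 ∧
      a * Real.cos a = - (pekZeta n₁ d k a * Real.sin a) := by
  have hp : 0 < pekM n₁ d k ^ 2 - a ^ 2 := by nlinarith [ha.1, ha.2]
  have hz : 0 < pekZeta n₁ d k a := Real.sqrt_pos.mpr hp
  refine ⟨hz, Real.sq_sqrt hp.le, ?_⟩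
  change Real.tan a = - a / pekZeta n₁ d k a at ht
  have h0 := ha.1
  have hc : Real.cos a ≠ 0 := by
    intro hc
    rw [Real.tan_eq_sin_div_cos, hc, div_zero, eq_comm, div_eq_zero_iff] at ht
    rcases ht with h | h <;> linarith
  rw [Real.tan_eq_sin_div_cos, div_eq_div_iff hc hz.ne'] at ht
  linarith

/-- The family `(φ_j)_{j=1}^N` of propagating Pekeris modes is orthonormal in `L²(0,∞)`. -/
theorem pekeris_modes_orthonormal (n₁ d k : ℝ) (hn : 1 < n₁) (hd : 0 < d) (hk : 0 < k)
    (σ : ℕ → ℝ) (hσ : IsModeFamily n₁ d k σ) :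
    ∀ j l : ℕ, 1 ≤ j → j ≤ pekN n₁ d k → 1 ≤ l → l ≤ pekN n₁ d k →
      (∫ x in Set.Ioi (0 : ℝ), pekPhi n₁ d k (σ j) x * pekPhi n₁ d k (σ l) x) =
        if j = l then 1 else 0 := by
  intro j l hj1 hj hl1 hl
  obtain ⟨Ij, hMj, htj⟩ := hσ j hj1 hj
  obtain ⟨Il, hMl, htl⟩ := hσ l hl1 hl
  obtain ⟨zj, zj2, rj⟩ := pek_rel n₁ d k _ hMj htj
  obtain ⟨zl, zl2, rl⟩ := pek_rel n₁ d k _ hMl htl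
  rw [pek_split n₁ d k _ _ hd (by linarith)]
  have hj0 := hMj.1
  have hl0 := hMl.1
  by_cases h : j = l
  · subst h
    rw [if_pos rfl, pek_int_eq d _ hd hj0]
    have hD : 0 < 1 + Real.sin (σ j) ^ 2 / pekZeta n₁ d k (σ j)
        - Real.sin (2 * σ j) / (2 * σ j) := by
      have h1 : 0 ≤ Real.sin (σ j) ^ 2 / pekZeta n₁ d k (σ j) := by positivity
      have h2 : Real.sin (2 * σ j) / (2 * σ j) ≤ 0 := by
        apply div_nonpos_of_nonpos_of_nonneg _ (by linarith)
        rw [Real.sin_two_mul]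
        have h3 : σ j * (Real.sin (σ j) * Real.cos (σ j)) ≤ 0 := by
          have : σ j * (Real.sin (σ j) * Real.cos (σ j)) =
              -(pekZeta n₁ d k (σ j) * Real.sin (σ j) ^ 2) := by
            linear_combination Real.sin (σ j) * rj
          rw [this]
          have : 0 ≤ pekZeta n₁ d k (σ j) * Real.sin (σ j) ^ 2 := by positivity
          linarith
        have := nonpos_of_mul_nonpos_right h3 hj0
        linarith
      linarith
    have hA : pekA n₁ d k (σ j) * pekA n₁ d k (σ j) = _ :=
      Real.mul_self_sqrt (div_nonneg (by positivity) hD.le)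
    rw [hA]
    have e : d / 2 * (1 - Real.sin (2 * σ j) / (2 * σ j)) + Real.sin (σ j) * Real.sin (σ j) *
        (d / (pekZeta n₁ d k (σ j) + pekZeta n₁ d k (σ j))) =
        d / 2 * (1 + Real.sin (σ j) ^ 2 / pekZeta n₁ d k (σ j)
        - Real.sin (2 * σ j) / (2 * σ j)) := by
      field_simp
      ring
    rw [e]
    generalize 1 + Real.sin (σ j) ^ 2 / pekZeta n₁ d k (σ j)
        - Real.sin (2 * σ j) / (2 * σ j) = D at hD
    field_simp
  · rw [if_neg h]
    have hne : σ j ≠ σ l := by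
      intro he
      have hpi := Real.pi_pos
      rcases Nat.lt_or_gt_of_ne h with h' | h'
      · have : (j : ℝ) + 1 ≤ l := by exact_mod_cast h'
        nlinarith [Ij.2, Il.1]
      · have : (l : ℝ) + 1 ≤ j := by exact_mod_cast h'
        nlinarith [Il.2, Ij.1]
    have hsq : σ j ^ 2 - σ l ^ 2 ≠ 0 := by
      have : σ j ^ 2 - σ l ^ 2 = (σ j - σ l) * (σ j + σ l) := by ring
      rw [this]
      exact mul_ne_zero (sub_ne_zero.mpr hne) (by linarith)
    rw [pek_int_ne d _ _ hd hsq]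
    apply mul_eq_zero_of_right
    have hz : pekZeta n₁ d k (σ j) + pekZeta n₁ d k (σ l) ≠ 0 := by linarith
    generalize pekZeta n₁ d k (σ j) = x at *
    generalize pekZeta n₁ d k (σ l) = y at *
    have num : σ l * Real.sin (σ j) * Real.cos (σ l) - σ j * Real.cos (σ j) * Real.sin (σ l)
        = Real.sin (σ j) * Real.sin (σ l) * (x - y) := by
      linear_combination Real.sin (σ j) * rl - Real.sin (σ l) * rj
    have hq : σ j ^ 2 - σ l ^ 2 = -((x - y) * (x + y)) := by linear_combination zj2 - zl2
    have hxy : x - y ≠ 0 := by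
      intro h0
      apply hsq
      rw [hq, h0]
      ring
    rw [num, hq]
    field_simp
    ring
end

section
/- For every α ∈ [0, 1) and all reals n₁ > 1, d > 0: lim_{k → ∞} max_{1 ≤ j ≤ ⌊N^α⌋} ‖φ_j − ψ_j‖_{L²(0,∞)} = 0, where ψ_j(x) = √(2/d)·sin(jπx/d) for 0 ≤ x ≤ d and ψ_j(x) = 0 for x ≥ d. In other words, in the limit of a large number of propagating modes the low-order Pekeris modes converge in L² to the modes of a perfect waveguide with pressure-release boundary conditions at x = 0 and x = d. -/
open Real Filter MeasureTheory

/-- The mode of a perfect waveguide with pressure-release boundary conditions at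
`x = 0` and `x = d`. -/
noncomputable def perfPsi (d : ℝ) (j : ℕ) : ℝ → ℝ := fun x =>
  if x ≤ d then Real.sqrt (2 / d) * Real.sin ((j : ℝ) * Real.pi * x / d) else 0

lemma pek_angle (y Z : ℝ) (j : ℕ) (hZ : 0 < Z) (hy : 0 < y)
    (h : y ∈ Set.Ioo (Real.pi / 2 + ((j : ℝ) - 1) * Real.pi) (Real.pi / 2 + (j : ℝ) * Real.pi))
    (ht : Real.tan y = - y / Z) :
    0 < j * π - y ∧ j * π - y < π / 2 ∧ j * π - y ≤ y / Z ∧ Real.sin (2 * y) ≤ 0 ∧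
      -Real.sin (2 * y) ≤ 2 * (y / Z) ∧ |Real.sin y| ≤ y / Z := by
  obtain ⟨h1, h2⟩ := h
  set e := j * π - y with he
  have hye : y = j * π - e := by rw [he]; ring
  have hr : 0 < y / Z := by positivity
  have e2 : e < π / 2 := by rw [he]; linarith
  have htan : Real.tan e = y / Z := by
    have : Real.tan e = - Real.tan y := by
      rw [he, Real.tan_nat_mul_pi_sub]
    rw [this, ht]; ring
  have e1 : 0 < e := by
    by_contra hc
    push Not at hc
    have : Real.tan e ≤ 0 := Real.tan_nonpos_of_nonpos_of_neg_pi_div_two_le hc (by rw [he]; linarith)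
    linarith
  have e3 : e ≤ y / Z := by rw [← htan]; exact (Real.lt_tan e1 e2).le
  have s2 : Real.sin (2 * y) = - Real.sin (2 * e) := by
    have : 2 * y = (j : ℝ) * (2 * π) - 2 * e := by rw [hye]; ring
    rw [this, Real.sin_nat_mul_two_pi_sub]
  refine ⟨e1, e2, e3, ?_, ?_, ?_⟩
  · rw [s2]
    have := Real.sin_nonneg_of_nonneg_of_le_pi (x := 2 * e) (by linarith) (by linarith)
    linarith
  · rw [s2]
    have := Real.sin_le (x := 2 * e) (by linarith)
    linarith
  · have : |Real.sin y| = |Real.sin e| := by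
      rw [he, Real.sin_nat_mul_pi_sub, abs_neg, abs_mul]; simp
    rw [this]
    have := Real.abs_sin_le_abs (x := e)
    rw [abs_of_pos e1] at this
    linarith

lemma pek_A_bound (n₁ d k y r : ℝ) (hd : 0 < d) (hZ : 0 < pekZeta n₁ d k y) (hy : 1 ≤ y)
    (hr : r = y / pekZeta n₁ d k y)
    (h1 : Real.sin (2 * y) ≤ 0) (h2 : -Real.sin (2 * y) ≤ 2 * r) :
    0 ≤ pekA n₁ d k y ∧ pekA n₁ d k y ≤ √(2 / d) ∧
      √(2 / d) - pekA n₁ d k y ≤ √(2 / d) * (2 * r) := by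
  set Z := pekZeta n₁ d k y with hZd
  have hZr : 1 / Z ≤ r := by rw [hr]; gcongr
  set D := 1 + Real.sin y ^ 2 / Z - Real.sin (2 * y) / (2 * y) with hD
  have a1 : 0 ≤ Real.sin y ^ 2 / Z := by positivity
  have a2 : Real.sin y ^ 2 / Z ≤ 1 / Z := by
    gcongr; exact Real.sin_sq_le_one y
  have a3 : 0 ≤ -Real.sin (2 * y) / (2 * y) := div_nonneg (by linarith) (by linarith)
  have a4 : -Real.sin (2 * y) / (2 * y) ≤ r := by
    rw [div_le_iff₀ (by linarith)]
    have : 0 < 1 / Z := by positivity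
    nlinarith
  have a5 : -Real.sin (2 * y) / (2 * y) = - (Real.sin (2 * y) / (2 * y)) := by ring
  have D1 : 1 ≤ D := by linarith
  have D2 : D ≤ 1 + 2 * r := by linarith
  have hA : pekA n₁ d k y = √(2 / d) / √D := by
    rw [pekA, ← hZd, ← hD, Real.sqrt_div (by positivity)]
  have s1 : 1 ≤ √D := Real.one_le_sqrt.mpr D1
  have s2 : √D ≤ D := by
    rw [Real.sqrt_le_left (by linarith)]; nlinarith
  have hs := Real.sqrt_nonneg (2 / d)
  refine ⟨by rw [hA]; positivity, by rw [hA]; exact div_le_self hs s1, ?_⟩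
  have : √(2 / d) - pekA n₁ d k y = √(2 / d) * (1 - 1 / √D) := by rw [hA]; ring
  rw [this]
  gcongr
  have : 1 / √D * √D = 1 := by field_simp
  have p : 0 < 1 / √D := by positivity
  have p1 : 1 / √D ≤ 1 := by rw [div_le_one (by linarith)]; exact s1
  nlinarith

lemma pek_pointwise (n₁ d k y r : ℝ) (j : ℕ) (hd : 0 < d) (hZ : 0 < pekZeta n₁ d k y)
    (hy : 1 ≤ y) (hr : r = y / pekZeta n₁ d k y) (hr1 : r ≤ 1)
    (h : y ∈ Set.Ioo (Real.pi / 2 + ((j : ℝ) - 1) * Real.pi) (Real.pi / 2 + (j : ℝ) * Real.pi))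
    (ht : Real.tan y = - y / pekZeta n₁ d k y) (x : ℝ) (hx : 0 < x) :
    (pekPhi n₁ d k y x - perfPsi d j x) ^ 2 ≤
      (2 / d * (9 * r ^ 2) * Real.exp 1) * Real.exp (-(1 / d) * x) := by
  obtain ⟨e1, e2, e3, s1, s2, s3⟩ := pek_angle y _ j hZ (by linarith) h ht
  rw [← hr] at e3 s2 s3
  obtain ⟨A0, A1, A2⟩ := pek_A_bound n₁ d k y r hd hZ hy hr s1 s2
  set A := pekA n₁ d k y with hA
  set Z := pekZeta n₁ d k y with hZd
  have hB : √(2 / d) ^ 2 = 2 / d := Real.sq_sqrt (by positivity)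
  set B := √(2 / d) with hBd
  have hB0 : 0 ≤ B := Real.sqrt_nonneg _
  have hr0 : 0 < r := by rw [hr]; positivity
  have hexp : Real.exp 1 * Real.exp (-(1 / d) * x) = Real.exp (-((x - d) / d)) := by
    rw [← Real.exp_add]; congr 1; field_simp; ring
  rw [mul_assoc, hexp, ← hB]
  by_cases hxd : x ≤ d
  · simp only [pekPhi, perfPsi, if_pos hxd, ← hA, ← hBd]
    have hE : 1 ≤ Real.exp (-((x - d) / d)) := by
      rw [Real.one_le_exp_iff, ← neg_div]
      exact div_nonneg (by linarith) hd.le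
    have hs : |Real.sin (y * x / d) - Real.sin (j * π * x / d)| ≤ r := by
      have l : |Real.sin (y * x / d) - Real.sin (j * π * x / d)| ≤ |y * x / d - j * π * x / d| :=
        Real.abs_sin_sub_sin_le _ _
      have : y * x / d - j * π * x / d = -((j * π - y) * (x / d)) := by ring
      rw [this, abs_neg, abs_of_nonneg (a := (j * π - y) * (x / d)) (mul_nonneg e1.le (by positivity))] at l
      have : x / d ≤ 1 := by rw [div_le_one hd]; exact hxd
      have : (j * π - y) * (x / d) ≤ (j * π - y) * 1 := by gcongr
      linarith
    have hm : |A * Real.sin (y * x / d) - B * Real.sin (j * π * x / d)| ≤ B * (3 * r) := by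
      have : A * Real.sin (y * x / d) - B * Real.sin (j * π * x / d) =
        (-(B - A)) * Real.sin (y * x / d) + B * (Real.sin (y * x / d) - Real.sin (j * π * x / d)) := by
        ring
      rw [this]
      refine (abs_add_le _ _).trans ?_
      rw [abs_mul, abs_mul, abs_neg, abs_of_nonneg hB0, abs_of_nonneg (sub_nonneg.2 A1)]
      have q1 : (B - A) * |Real.sin (y * x / d)| ≤ (B - A) * 1 :=
        mul_le_mul_of_nonneg_left (Real.abs_sin_le_one _) (sub_nonneg.2 A1)
      have q2 := mul_le_mul_of_nonneg_left hs hB0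
      linarith
    have := sq_le_sq' (abs_le.1 hm).1 (abs_le.1 hm).2
    have hp : 0 ≤ B ^ 2 * (9 * r ^ 2) := by positivity
    nlinarith
  · simp only [pekPhi, perfPsi, if_neg hxd, ← hA, sub_zero, ← hZd]
    push Not at hxd
    have hZ1 : 1 ≤ Z := by
      rw [hr, div_le_one hZ] at hr1; linarith
    have t0 : 0 ≤ (x - d) / d := div_nonneg (by linarith) hd.le
    rw [mul_pow, mul_pow, ← Real.exp_nat_mul]
    have hE : Real.exp ((2 : ℕ) * (-Z * (x - d) / d)) ≤ Real.exp (-((x - d) / d)) := by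
      apply Real.exp_le_exp.2
      have : ((2 : ℕ) : ℝ) * (-Z * (x - d) / d) = -(2 * Z * ((x - d) / d)) := by push_cast; ring
      rw [this]
      nlinarith
    have hs : Real.sin y ^ 2 ≤ 9 * r ^ 2 := by
      have := sq_le_sq' (abs_le.1 s3).1 (abs_le.1 s3).2
      nlinarith
    gcongr

lemma pek_norm (n₁ d k y r : ℝ) (j : ℕ) (hd : 0 < d) (hZ : 0 < pekZeta n₁ d k y)
    (hy : 1 ≤ y) (hr : r = y / pekZeta n₁ d k y) (hr1 : r ≤ 1)
    (h : y ∈ Set.Ioo (Real.pi / 2 + ((j : ℝ) - 1) * Real.pi) (Real.pi / 2 + (j : ℝ) * Real.pi))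
    (ht : Real.tan y = - y / pekZeta n₁ d k y) :
    Real.sqrt (∫ x in Set.Ioi (0 : ℝ), (pekPhi n₁ d k y x - perfPsi d j x) ^ 2) ≤ 8 * r := by
  have hr0 : 0 < r := by rw [hr]; positivity
  have hdi : -(1 / d) < 0 := by simp [hd]
  have hI := integrableOn_exp_mul_Ioi hdi 0
  have hle : ∫ x in Set.Ioi (0 : ℝ), (pekPhi n₁ d k y x - perfPsi d j x) ^ 2 ≤
      ∫ x in Set.Ioi (0 : ℝ), (2 / d * (9 * r ^ 2) * Real.exp 1) * Real.exp (-(1 / d) * x) := by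
    refine integral_mono_of_nonneg (ae_of_all _ fun x => sq_nonneg _) (hI.const_mul _) ?_
    filter_upwards [ae_restrict_mem measurableSet_Ioi] with x hx
    exact pek_pointwise n₁ d k y r j hd hZ hy hr hr1 h ht x hx
  rw [integral_const_mul, integral_exp_mul_Ioi hdi] at hle
  have : 2 / d * (9 * r ^ 2) * Real.exp 1 * (-Real.exp (-(1 / d) * 0) / -(1 / d)) =
      18 * r ^ 2 * Real.exp 1 := by
    simp; field_simp; ring
  rw [this] at hle
  rw [Real.sqrt_le_left (by positivity)]
  have := Real.exp_one_lt_three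
  nlinarith [sq_nonneg r]

lemma pek_mode (n₁ d k q : ℝ) (σ : ℕ → ℝ) (j : ℕ) (hd : 0 < d) (hM : 0 < pekM n₁ d k)
    (hσ : IsModeFamily n₁ d k σ) (hj : 1 ≤ j) (hjN : j ≤ pekN n₁ d k) (hq : q ≤ 1 / 2)
    (hjq : j * π ≤ q * pekM n₁ d k) :
    Real.sqrt (∫ x in Set.Ioi (0 : ℝ), (pekPhi n₁ d k (σ j) x - perfPsi d j x) ^ 2) ≤ 16 * q := by
  obtain ⟨h1, h2, ht⟩ := hσ j hj hjN
  have hZ : 0 < pekZeta n₁ d k (σ j) := by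
    apply Real.sqrt_pos.2
    have := h2.1
    have := h2.2
    nlinarith
  have hpi := Real.pi_gt_three
  have hj' : (1 : ℝ) ≤ j := by exact_mod_cast hj
  have hy : 1 ≤ σ j := by
    have := h1.1
    nlinarith
  obtain ⟨e1, -⟩ := pek_angle _ _ j hZ h2.1 h1 ht
  have hs : σ j ≤ q * pekM n₁ d k := by linarith
  have hZM : pekM n₁ d k / 2 ≤ pekZeta n₁ d k (σ j) := by
    apply Real.le_sqrt_of_sq_le
    have h3 : σ j ≤ pekM n₁ d k / 2 := by nlinarith
    nlinarith
  have hr : σ j / pekZeta n₁ d k (σ j) ≤ 2 * q := by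
    rw [div_le_iff₀ hZ]
    have : 0 < q := by
      by_contra hc
      push Not at hc
      nlinarith
    nlinarith
  have := pek_norm n₁ d k (σ j) _ j hd hZ hy rfl (by linarith) h1 ht
  linarith

/-- For `α ∈ [0,1)`, the maximal `L²(0,∞)`-distance between the low order Pekeris modes
`φ_j`, `1 ≤ j ≤ ⌊N^α⌋`, and the corresponding perfect-waveguide modes `ψ_j` tends to `0`
as `k → ∞`. -/
theorem low_modes_converge_to_perfect_waveguide (α n₁ d : ℝ)
    (hα : α ∈ Set.Ico (0 : ℝ) 1) (hn : 1 < n₁) (hd : 0 < d)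
    (σ : ℝ → ℕ → ℝ) (hσ : ∀ k > (0 : ℝ), IsModeFamily n₁ d k (σ k)) :
    Filter.Tendsto (fun k : ℝ =>
        ⨆ j ∈ Finset.Icc 1 (Nat.floor ((pekN n₁ d k : ℝ) ^ α)),
          Real.sqrt (∫ x in Set.Ioi (0 : ℝ),
            (pekPhi n₁ d k (σ k j) x - perfPsi d j x) ^ 2))
      Filter.atTop (nhds 0) := by
  obtain ⟨hα0, hα1⟩ := hα
  have hθ : 0 < pekTheta n₁ := by
    apply Real.sqrt_pos.2
    have : 1 / n₁ ^ 2 < 1 := by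
      rw [div_lt_one (by positivity)]
      nlinarith
    linarith
  have hc : 0 < n₁ * d * pekTheta n₁ := by positivity
  have hMt : Tendsto (fun k => pekM n₁ d k / π) atTop atTop := by
    have : (fun k => pekM n₁ d k / π) = fun k => k * (n₁ * d * pekTheta n₁ / π) := by
      funext k; simp only [pekM]; ring
    rw [this]
    exact tendsto_id.atTop_mul_const (by positivity)
  have hq : Tendsto (fun k => (pekM n₁ d k / π) ^ (-(1 - α))) atTop (nhds 0) :=
    (tendsto_rpow_neg_atTop (by linarith)).comp hMt
  have hq16 : Tendsto (fun k => 16 * (pekM n₁ d k / π) ^ (-(1 - α))) atTop (nhds 0) := by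
    simpa using hq.const_mul 16
  refine squeeze_zero' (Eventually.of_forall fun k => ?_) ?_ hq16
  · exact Real.iSup_nonneg fun j => Real.iSup_nonneg fun _ => Real.sqrt_nonneg _
  · filter_upwards [eventually_gt_atTop 0, hMt.eventually_ge_atTop 1,
      hq.eventually_le_const (show (0 : ℝ) < 1 / 2 by norm_num)] with k hk hm hq2
    set m := pekM n₁ d k / π with hmd
    have hM : pekM n₁ d k = m * π := by rw [hmd]; field_simp
    have hq0 : 0 ≤ m ^ (-(1 - α)) := by positivity
    refine Real.iSup_le (fun j => Real.iSup_le (fun hj => ?_) (by positivity)) (by positivity)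
    rw [Finset.mem_Icc] at hj
    have hN1 : 1 ≤ pekN n₁ d k := Nat.le_floor (by simpa using hm)
    have hN1' : (1 : ℝ) ≤ pekN n₁ d k := by exact_mod_cast hN1
    have hNm : (pekN n₁ d k : ℝ) ≤ m := Nat.floor_le (by positivity)
    have hjr : (j : ℝ) ≤ (pekN n₁ d k : ℝ) ^ α :=
      (Nat.le_floor_iff (by positivity)).1 hj.2
    have hjN : j ≤ pekN n₁ d k := by
      have : (pekN n₁ d k : ℝ) ^ α ≤ (pekN n₁ d k : ℝ) ^ (1 : ℝ) :=
        Real.rpow_le_rpow_of_exponent_le hN1' hα1.le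
      rw [Real.rpow_one] at this
      exact_mod_cast hjr.trans this
    refine pek_mode n₁ d k _ (σ k) j hd (by rw [hM]; positivity) (hσ k hk) hj.1 hjN hq2 ?_
    have h3 : (pekN n₁ d k : ℝ) ^ α ≤ m ^ α := Real.rpow_le_rpow (by positivity) hNm hα0
    have h4 : m ^ (-(1 - α)) * m = m ^ α := by
      rw [← Real.rpow_add_one (by positivity)]; congr 1; ring
    rw [hM, ← mul_assoc, h4]
    gcongr
    linarith
end

section
/- Let E be a complex Hilbert space and let H : [0, ∞) → B(E) be a norm-continuous family of bounded operators such that H(z) is skew-adjoint (H(z)* = −H(z)) for every z ≥ 0. Let T : [0, ∞) → B(E) be differentiable in operator norm with T(0) = Id and T'(z) = H(z) ∘ T(z) for all z ≥ 0. Then T(z) is unitary for every z ≥ 0, i.e. T(z)* ∘ T(z) = Id and T(z) ∘ T(z)* = Id. -/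
open ContinuousLinearMap

/-- If `H : [0,∞) → B(E)` is a norm-continuous family of skew-adjoint bounded operators on
a complex Hilbert space `E` and `T` solves `T' = H∘T`, `T(0) = Id`, then `T(z)` is unitary
for every `z ≥ 0`. -/
theorem transfer_operator_unitary
    {E : Type*} [NormedAddCommGroup E] [InnerProductSpace ℂ E] [CompleteSpace E]
    (H : ℝ → E →L[ℂ] E) (hHcont : ContinuousOn H (Set.Ici 0))
    (hskew : ∀ z : ℝ, 0 ≤ z → ContinuousLinearMap.adjoint (H z) = - H z)
    (T : ℝ → E →L[ℂ] E) (hT0 : T 0 = ContinuousLinearMap.id ℂ E)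
    (hT : ∀ z : ℝ, 0 ≤ z → HasDerivWithinAt T ((H z).comp (T z)) (Set.Ici 0) z) :
    ∀ z : ℝ, 0 ≤ z →
      (ContinuousLinearMap.adjoint (T z)).comp (T z) = ContinuousLinearMap.id ℂ E ∧
      (T z).comp (ContinuousLinearMap.adjoint (T z)) = ContinuousLinearMap.id ℂ E := by
  have hTs : ∀ z : ℝ, 0 ≤ z →
      HasDerivWithinAt (fun z => star (T z)) (star (H z * T z)) (Set.Ici 0) z :=
    fun z hz => (hT z hz).star
  have hTm : ∀ z : ℝ, 0 ≤ z → HasDerivWithinAt T (H z * T z) (Set.Ici 0) z := hT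
  have hsk : ∀ z : ℝ, 0 ≤ z → star (H z) = - H z := hskew
  have hT0' : T 0 = 1 := hT0
  intro b hb
  constructor
  · have hd : ∀ z : ℝ, 0 ≤ z →
        HasDerivWithinAt (fun z => star (T z) * T z) 0 (Set.Ici 0) z := by
      intro z hz
      refine ((hTs z hz).mul (hTm z hz)).congr_deriv ?_
      rw [star_mul, hsk z hz]
      noncomm_ring
    have h := constant_of_has_deriv_right_zero (f := fun z => star (T z) * T z) (a := 0) (b := b)
      (fun x hx => ((hd x hx.1).continuousWithinAt).mono Set.Icc_subset_Ici_self)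
      (fun x hx => (hd x hx.1).mono (Set.Ici_subset_Ici.2 hx.1)) b ⟨hb, le_rfl⟩
    simp only [hT0', star_one, mul_one] at h
    exact h
  · have hd : ∀ z : ℝ, 0 ≤ z →
        HasDerivWithinAt (fun z => T z * star (T z) - 1)
          (H z * (T z * star (T z) - 1) - (T z * star (T z) - 1) * H z) (Set.Ici 0) z := by
      intro z hz
      refine (((hTm z hz).mul (hTs z hz)).sub_const 1).congr_deriv ?_
      rw [star_mul, hsk z hz]
      noncomm_ring
    obtain ⟨K, hK⟩ := (isCompact_Icc (a := (0 : ℝ)) (b := b)).exists_bound_of_continuousOn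
      (hHcont.mono Set.Icc_subset_Ici_self)
    have h := norm_le_gronwallBound_of_norm_deriv_right_le
      (f := fun z => T z * star (T z) - 1) (a := 0) (b := b) (δ := 0) (K := 2 * K) (ε := 0)
      (fun x hx => ((hd x hx.1).continuousWithinAt).mono Set.Icc_subset_Ici_self)
      (fun x hx => (hd x hx.1).mono (Set.Ici_subset_Ici.2 hx.1))
      (by simp [hT0'])
      (by
        intro x hx
        have hKx := hK x ⟨hx.1, hx.2.le⟩
        generalize T x * star (T x) - 1 = D
        have h1 := norm_sub_le (H x * D) (D * H x)
        have h2 := norm_mul_le (H x) D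
        have h3 := norm_mul_le D (H x)
        have h4 := mul_le_mul_of_nonneg_right hKx (norm_nonneg D)
        linarith) b ⟨hb, le_rfl⟩
    rw [gronwallBound_ε0_δ0, norm_le_zero_iff, sub_eq_zero] at h
    exact h
end

section
/- Let n ≥ 1, Z > 0, and let H^{aa}, H^{ab} : [0, Z] → M_n(ℂ) be continuous matrix-valued functions such that for every z ∈ [0, Z], H^{aa}(z) is skew-Hermitian (H^{aa}(z)* = −H^{aa}(z)) and H^{ab}(z) is complex symmetric (H^{ab}(z)ᵀ = H^{ab}(z)). Let a, b : [0, Z] → ℂⁿ be continuously differentiable and satisfy the coupled mode equations a'(z) = H^{aa}(z)a(z) + H^{ab}(z)b(z) and b'(z) = conj(H^{ab}(z))a(z) + conj(H^{aa}(z))b(z), where conj denotes the entrywise complex conjugate matrix. Then the quantity ‖a(z)‖² − ‖b(z)‖² (squared Euclidean norms) is constant on [0, Z]. -/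
open Matrix

/-- Conservation of the net energy flux `‖a(z)‖² − ‖b(z)‖²` for the coupled mode equations
`a' = H^{aa}a + H^{ab}b`, `b' = conj(H^{ab})a + conj(H^{aa})b` with `H^{aa}` skew-Hermitian
and `H^{ab}` complex symmetric. -/
theorem energy_flux_conservation (n : ℕ) (hn : 1 ≤ n) (Z : ℝ) (hZ : 0 < Z)
    (Haa Hab : ℝ → Matrix (Fin n) (Fin n) ℂ)
    (hcont_aa : ContinuousOn Haa (Set.Icc 0 Z)) (hcont_ab : ContinuousOn Hab (Set.Icc 0 Z))
    (hskew : ∀ z ∈ Set.Icc (0 : ℝ) Z, (Haa z)ᴴ = - Haa z)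
    (hsym : ∀ z ∈ Set.Icc (0 : ℝ) Z, (Hab z)ᵀ = Hab z)
    (a b : ℝ → Fin n → ℂ)
    (ha : ∀ z ∈ Set.Icc (0 : ℝ) Z,
      HasDerivWithinAt a ((Haa z).mulVec (a z) + (Hab z).mulVec (b z)) (Set.Icc 0 Z) z)
    (hb : ∀ z ∈ Set.Icc (0 : ℝ) Z,
      HasDerivWithinAt b (((Hab z).map (starRingEnd ℂ)).mulVec (a z) +
        ((Haa z).map (starRingEnd ℂ)).mulVec (b z)) (Set.Icc 0 Z) z) :
    ∀ z ∈ Set.Icc (0 : ℝ) Z,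
      (∑ j, ‖a z j‖ ^ 2) - (∑ j, ‖b z j‖ ^ 2) =
        (∑ j, ‖a 0 j‖ ^ 2) - (∑ j, ‖b 0 j‖ ^ 2) := by
  have key : ∀ z ∈ Set.Icc (0 : ℝ) Z, HasDerivWithinAt
      (fun z => (∑ j, star (a z j) * a z j) - (∑ j, star (b z j) * b z j)) 0 (Set.Icc 0 Z) z := by
    intro z hz
    have ha' := fun j => (hasDerivWithinAt_pi.1 (ha z hz)) j
    have hb' := fun j => (hasDerivWithinAt_pi.1 (hb z hz)) j
    have hA : ∀ j k, star (Haa z j k) = - Haa z k j := fun j k => by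
      have := congrFun (congrFun (hskew z hz) k) j
      simpa using this
    have hB : ∀ j k, Hab z j k = Hab z k j := fun j k => by
      have := congrFun (congrFun (hsym z hz) k) j
      simpa using this
    have h := (HasDerivWithinAt.fun_sum (u := Finset.univ)
        (fun j _ => (ha' j).star.mul (ha' j))).sub
      (HasDerivWithinAt.fun_sum (u := Finset.univ) (fun j _ => (hb' j).star.mul (hb' j)))
    refine h.congr_deriv ?_
    have e1 : ∑ j, star (((Haa z).mulVec (a z) + (Hab z).mulVec (b z)) j) * a z j
        = ∑ j, ∑ k, (- (star (a z j) * Haa z j k * a z k)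
          + star (b z j) * star (Hab z j k) * a z k) := by
      rw [Finset.sum_comm]
      refine Finset.sum_congr rfl fun j _ => ?_
      simp only [Pi.add_apply, Matrix.mulVec, dotProduct, ← Finset.sum_add_distrib, star_sum,
        Finset.sum_mul]
      refine Finset.sum_congr rfl fun k _ => ?_
      rw [star_add, star_mul', star_mul', hA, hB j k]
      ring
    have e2 : ∑ j, star ((((Hab z).map (starRingEnd ℂ)).mulVec (a z) +
        ((Haa z).map (starRingEnd ℂ)).mulVec (b z)) j) * b z j
        = ∑ j, ∑ k, (star (a z j) * Hab z j k * b z k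
          - star (b z j) * star (Haa z j k) * b z k) := by
      rw [Finset.sum_comm]
      refine Finset.sum_congr rfl fun j _ => ?_
      simp only [Pi.add_apply, Matrix.mulVec, dotProduct, ← Finset.sum_add_distrib, star_sum,
        Finset.sum_mul, Matrix.map_apply, starRingEnd_apply]
      refine Finset.sum_congr rfl fun k _ => ?_
      rw [star_add, star_mul', star_mul', star_star, star_star, hA k j, hB j k]
      ring
    rw [Finset.sum_add_distrib, Finset.sum_add_distrib, e1, e2, ← Finset.sum_add_distrib,
      ← Finset.sum_add_distrib, ← Finset.sum_sub_distrib]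
    refine Finset.sum_eq_zero fun j _ => ?_
    simp only [Pi.add_apply, Matrix.mulVec, dotProduct, ← Finset.sum_add_distrib,
      Finset.mul_sum, Matrix.map_apply, starRingEnd_apply, ← Finset.sum_sub_distrib]
    refine Finset.sum_eq_zero fun k _ => ?_
    ring
  have hconst := constant_of_derivWithin_zero (fun z hz => (key z hz).differentiableWithinAt)
    (fun z hz => (key z (Set.Ico_subset_Icc_self hz)).derivWithin
      (uniqueDiffOn_Icc hZ z (Set.Ico_subset_Icc_self hz)))
  intro z hz
  have h := hconst z hz
  have e : ∀ w : ℂ, star w * w = ((‖w‖ ^ 2 : ℝ) : ℂ) := fun w => by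
    have := Complex.conj_mul' w
    push_cast
    exact this
  simp only [e] at h
  exact_mod_cast h
end

section
/- Fix n₁ > 1, d > 0, k > 0 and assume cos(d·√(n₁²k² − k²)) ≠ 0. Then for every ξ₀ ∈ (0, k²), L > 0 and B > 0 there exists a constant C > 0 such that for all ε ∈ (0, 1] and all x, y ∈ [0, B]: | ∫_{ξ₀}^{k²} φ_γ(x)·φ_γ(y)·e^{i√γ·L/ε} dγ | ≤ C·ε. (The radiating components of the refocused wave are of order ε, uniformly on bounded sets.) -/
open Real MeasureTheory

/-- The radiating mode `φ_γ` of the Pekeris waveguide, for `γ ∈ (0, k²)`. -/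
noncomputable def radPhi (n₁ d k γ : ℝ) : ℝ → ℝ := fun x =>
  let η : ℝ := d * Real.sqrt (n₁ ^ 2 * k ^ 2 - γ)
  let ξ : ℝ := d * Real.sqrt (k ^ 2 - γ)
  let A : ℝ := Real.sqrt (d * ξ /
    (Real.pi * (ξ ^ 2 * Real.sin η ^ 2 + η ^ 2 * Real.cos η ^ 2)))
  if x ≤ d then A * Real.sin (η * x / d)
  else A * (Real.sin η * Real.cos (ξ * (x - d) / d) +
    (η / ξ) * Real.cos η * Real.sin (ξ * (x - d) / d))


lemma sinc_cd : ContDiff ℝ 1 Real.sinc := by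
  rw [contDiff_iff_contDiffAt]
  intro x
  by_cases hx : x = 0
  · subst hx
    rw [Real.sinc_eq_dslope]
    obtain ⟨p, hp⟩ := Real.analyticAt_sin (x := 0)
    exact (hp.has_fpower_series_dslope_fslope).analyticAt.contDiffAt
  · have : ContDiffAt ℝ 1 (fun x : ℝ => Real.sin x / x) x :=
      Real.contDiff_sin.contDiffAt.div contDiffAt_id hx
    refine this.congr_of_eventuallyEq ?_
    filter_upwards [isOpen_ne.mem_nhds hx] with y hy
    exact Real.sinc_of_ne_zero hy

lemma osc (k s0 L M ε : ℝ) (hk : 0 < k) (hs : 0 < s0) (hsk : s0 < k) (hL : 0 < L)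
    (hε : 0 < ε) (g g' : ℝ → ℝ) (hg : ∀ s, HasDerivAt g (g' s) s)
    (hg' : Continuous g') (h1 : ∀ s ∈ Set.Icc 0 s0, |g s| ≤ M)
    (h2 : ∀ s ∈ Set.Icc 0 s0, |g' s| ≤ M) :
    ‖∫ s in Set.Ioo 0 s0, (2 * s : ℂ) * (g s : ℂ) *
        Complex.exp (Complex.I * ((Real.sqrt (k ^ 2 - s ^ 2) : ℝ) * L / ε))‖ ≤
      (((2 * M * k + 2 * M * (k / Real.sqrt (k ^ 2 - s0 ^ 2))) * s0 + 4 * M * k) / L) * ε := by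
  have hM : 0 ≤ M := (abs_nonneg _).trans (h1 0 ⟨le_rfl, hs.le⟩)
  set P : ℝ → ℝ := fun s => Real.sqrt (k ^ 2 - s ^ 2) with hP
  set E : ℝ → ℂ := fun s => Complex.exp (Complex.I * ((P s : ℝ) * L / ε)) with hE
  have hpos : ∀ s ∈ Set.Icc 0 s0, 0 < k ^ 2 - s ^ 2 := by
    intro s hs'; nlinarith [hs'.1, hs'.2]
  have hPpos : ∀ s ∈ Set.Icc 0 s0, 0 < P s := fun s hs' => Real.sqrt_pos.2 (hpos s hs')
  have hPk : ∀ s, P s ≤ k := by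
    intro s
    calc P s ≤ Real.sqrt (k ^ 2) := Real.sqrt_le_sqrt (by nlinarith)
      _ = k := Real.sqrt_sq hk.le
  have hPlow : ∀ s ∈ Set.Icc 0 s0, P s0 ≤ P s := by
    intro s hs'
    exact Real.sqrt_le_sqrt (by nlinarith [hs'.1, hs'.2])
  have hEn : ∀ s, ‖E s‖ = 1 := by
    intro s
    have : Complex.I * ((P s : ℝ) * L / ε) = ((P s * L / ε : ℝ) : ℂ) * Complex.I := by
      push_cast; ring
    simp only [hE]
    rw [this, Complex.norm_exp_ofReal_mul_I]
  have hPd : ∀ s ∈ Set.Icc 0 s0, HasDerivAt P (-s / P s) s := by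
    intro s hs'
    have h := ((hasDerivAt_pow 2 s).const_sub (k ^ 2)).sqrt (hpos s hs').ne'
    convert h using 1
    change -s / P s = _ / (2 * P s)
    have := (hPpos s hs').ne'
    field_simp
    norm_num
    ring
  have hPc : Continuous P := by fun_prop
  have hEc : Continuous E := by fun_prop
  have hgc : Continuous g := continuous_iff_continuousAt.2 fun s => (hg s).continuousAt
  have hV : ∀ s ∈ Set.Icc 0 s0, HasDerivAt (fun s => (2 * (g s * P s) : ℂ) * E s)
      (((2 * (g' s * P s + g s * (-s / P s)) : ℝ) : ℂ) * E s
        - (Complex.I * L / ε) * ((2 * s : ℂ) * (g s : ℂ) * E s)) s := by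
    intro s hs'
    have e1 := (hPd s hs').ofReal_comp
    have e2 := (hg s).ofReal_comp
    have e3 : HasDerivAt E _ s := (((e1.mul_const (L:ℂ)).div_const (ε:ℂ)).const_mul Complex.I).cexp
    have := ((e2.mul e1).const_mul (2:ℂ)).mul e3
    refine HasDerivAt.congr_deriv (f := fun s => (2 * (g s * P s) : ℂ) * E s) this ?_
    have hp : (P s : ℂ) ≠ 0 := by exact_mod_cast (hPpos s hs').ne'
    have hε' : (ε : ℂ) ≠ 0 := by exact_mod_cast hε.ne'
    push_cast
    change _ * E s + 2 * ((g s : ℂ) * (P s : ℂ)) * (E s * _) = _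
    field_simp
    ring
  have hu : Set.uIcc 0 s0 = Set.Icc 0 s0 := Set.uIcc_of_le hs.le
  have c1 : ContinuousOn (fun s => ((2 * (g' s * P s + g s * (-s / P s)) : ℝ) : ℂ) * E s)
      (Set.uIcc 0 s0) := by
    rw [hu]
    refine ContinuousOn.mul ?_ hEc.continuousOn
    refine Complex.continuous_ofReal.comp_continuousOn ?_
    refine continuousOn_const.mul ((hg'.mul hPc).continuousOn.add (hgc.continuousOn.mul ?_))
    exact (continuous_neg.continuousOn).div hPc.continuousOn fun s hs' => (hPpos s hs').ne'
  have c2 : Continuous (fun s : ℝ => (2 * s : ℂ) * (g s : ℂ) * E s) := by fun_prop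
  have i1 := c1.intervalIntegrable (μ := volume)
  have i2 := c2.intervalIntegrable (μ := volume) 0 s0
  have ftc := intervalIntegral.integral_eq_sub_of_hasDerivAt (fun s hs' => hV s (hu ▸ hs'))
    (i1.sub (i2.const_mul (Complex.I * L / ε)))
  rw [intervalIntegral.integral_sub i1 (i2.const_mul _), intervalIntegral.integral_const_mul] at ftc
  have b1 : ‖∫ s in (0:ℝ)..s0, ((2 * (g' s * P s + g s * (-s / P s)) : ℝ) : ℂ) * E s‖ ≤
      (2 * M * k + 2 * M * (k / P s0)) * |s0 - 0| := by
    refine intervalIntegral.norm_integral_le_of_norm_le_const fun s hs' => ?_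
    rw [Set.uIoc_of_le hs.le] at hs'
    have hs' : s ∈ Set.Icc 0 s0 := ⟨hs'.1.le, hs'.2⟩
    rw [norm_mul, hEn, mul_one, Complex.norm_real, Real.norm_eq_abs, abs_mul, abs_two]
    have a1 : |g' s * P s| ≤ M * k := by
      rw [abs_mul, abs_of_pos (hPpos s hs')]
      exact mul_le_mul (h2 s hs') (hPk s) (hPpos s hs').le hM
    have a2 : |g s * (-s / P s)| ≤ M * (k / P s0) := by
      rw [abs_mul, abs_div, abs_neg, abs_of_pos (hPpos s hs'), abs_of_nonneg hs'.1]
      refine mul_le_mul (h1 s hs') ?_ (div_nonneg hs'.1 (hPpos s hs').le) hM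
      exact div_le_div₀ hk.le (hs'.2.trans hsk.le) (hPpos s0 ⟨hs.le, le_rfl⟩) (hPlow s hs')
    nlinarith [abs_add_le (g' s * P s) (g s * (-s / P s))]
  have b2 : ∀ s ∈ Set.Icc 0 s0, ‖(2 * (g s * P s) : ℂ) * E s‖ ≤ 2 * M * k := by
    intro s hs'
    rw [norm_mul, hEn, mul_one, norm_mul, norm_mul, Complex.norm_real, Complex.norm_real,
      Real.norm_eq_abs, Real.norm_eq_abs, abs_of_pos (hPpos s hs')]
    have := mul_le_mul (h1 s hs') (hPk s) (hPpos s hs').le hM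
    norm_num
    linarith
  rw [← integral_Ioc_eq_integral_Ioo, ← intervalIntegral.integral_of_le hs.le]
  set J := ∫ s in (0:ℝ)..s0, (2 * s : ℂ) * (g s : ℂ) * E s with hJ
  have hn : ‖(Complex.I * L / ε) * J‖ = L / ε * ‖J‖ := by
    rw [norm_mul, norm_div, norm_mul, Complex.norm_I, Complex.norm_real, Complex.norm_real,
      Real.norm_eq_abs, Real.norm_eq_abs, abs_of_pos hL, abs_of_pos hε, one_mul]
  have hf : (Complex.I * L / ε) * J = (∫ s in (0:ℝ)..s0, ((2 * (g' s * P s + g s * (-s / P s)) : ℝ) : ℂ) * E s)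
     - ((2 * (g s0 * P s0) : ℂ) * E s0 - (2 * (g 0 * P 0) : ℂ) * E 0) := by
    rw [← ftc]; ring
  have hb : L / ε * ‖J‖ ≤ (2 * M * k + 2 * M * (k / P s0)) * s0 + 4 * M * k := by
    rw [← hn, hf]
    rw [sub_zero, abs_of_pos hs] at b1
    have t1 := b2 s0 ⟨hs.le, le_rfl⟩
    have t2 := b2 0 ⟨le_rfl, hs.le⟩
    refine (norm_sub_le _ _).trans ?_
    have t3 := norm_sub_le ((2 * (g s0 * P s0) : ℂ) * E s0) ((2 * (g 0 * P 0) : ℂ) * E 0)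
    linarith
  rw [div_mul_eq_mul_div, le_div_iff₀ hL]
  rw [div_mul_eq_mul_div, div_le_iff₀ hε] at hb
  linarith

lemma osc_unif (k s0 L B : ℝ) (hk : 0 < k) (hs : 0 < s0) (hsk : s0 < k) (hL : 0 < L)
    (h : ℝ × ℝ × ℝ → ℝ) (hh : ContDiff ℝ 1 h) : ∃ C > (0:ℝ), ∀ ε > (0:ℝ),
    ∀ x ∈ Set.Icc 0 B, ∀ y ∈ Set.Icc 0 B, ‖∫ s in Set.Ioo 0 s0, (2 * s : ℂ) * (h (s, x, y) : ℂ) *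
        Complex.exp (Complex.I * ((Real.sqrt (k ^ 2 - s ^ 2) : ℝ) * L / ε))‖ ≤ C * ε := by
  have hK : IsCompact (Set.Icc (0:ℝ) s0 ×ˢ Set.Icc (0:ℝ) B ×ˢ Set.Icc (0:ℝ) B) :=
    isCompact_Icc.prod (isCompact_Icc.prod isCompact_Icc)
  have hfc : Continuous (fun p => fderiv ℝ h p (1, 0, 0)) :=
    (hh.continuous_fderiv one_ne_zero).clm_apply continuous_const
  obtain ⟨M1, hM1⟩ := hK.exists_bound_of_continuousOn hh.continuous.continuousOn
  obtain ⟨M2, hM2⟩ := hK.exists_bound_of_continuousOn hfc.continuousOn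
  set M := max 1 (max M1 M2) with hM
  have hM0 : 0 < M := lt_of_lt_of_le one_pos (le_max_left _ _)
  have hP : 0 < Real.sqrt (k ^ 2 - s0 ^ 2) := Real.sqrt_pos.2 (by nlinarith)
  refine ⟨(((2 * M * k + 2 * M * (k / Real.sqrt (k ^ 2 - s0 ^ 2))) * s0 + 4 * M * k) / L),
    by positivity, fun ε hε x hx y hy => ?_⟩
  refine osc k s0 L M ε hk hs hsk hL hε (fun s => h (s, x, y))
    (fun s => fderiv ℝ h (s, x, y) (1, 0, 0)) ?_ ?_ ?_ ?_
  · intro s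
    have e : HasDerivAt (fun s : ℝ => (s, x, y)) ((1:ℝ), (0:ℝ), (0:ℝ)) s :=
      (hasDerivAt_id s).prodMk (hasDerivAt_const s (x, y))
    exact ((hh.differentiable one_ne_zero) (s, x, y)).hasFDerivAt.comp_hasDerivAt s e
  · exact hfc.comp (by fun_prop)
  · intro s hs'
    exact (hM1 (s, x, y) ⟨hs', hx, hy⟩).trans ((le_max_left _ _).trans (le_max_right _ _))
  · intro s hs'
    exact (hM2 (s, x, y) ⟨hs', hx, hy⟩).trans ((le_max_right _ _).trans (le_max_right _ _))

/-- `η` in terms of `s = √(k² - γ)`. -/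
noncomputable def etaS (n₁ d k s : ℝ) : ℝ := d * Real.sqrt (n₁ ^ 2 * k ^ 2 - k ^ 2 + s ^ 2)

noncomputable def denS (n₁ d k s : ℝ) : ℝ :=
  Real.pi * ((d * s) ^ 2 * Real.sin (etaS n₁ d k s) ^ 2 +
    etaS n₁ d k s ^ 2 * Real.cos (etaS n₁ d k s) ^ 2)

noncomputable def wS (n₁ d k s : ℝ) : ℝ := d * (d * s) / denS n₁ d k s

noncomputable def fIn (n₁ d k s x : ℝ) : ℝ := Real.sin (etaS n₁ d k s * x / d)

noncomputable def fOut (n₁ d k s x : ℝ) : ℝ :=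
  Real.sin (etaS n₁ d k s) * Real.cos (s * (x - d)) +
    etaS n₁ d k s / d * Real.cos (etaS n₁ d k s) * ((x - d) * Real.sinc (s * (x - d)))

lemma base_pos (n₁ k : ℝ) (hn : 1 < n₁) (hk : 0 < k) : 0 < n₁ ^ 2 * k ^ 2 - k ^ 2 := by
  have : 0 < (n₁ ^ 2 - 1) * k ^ 2 := mul_pos (by nlinarith) (by positivity)
  linarith

lemma etaS_pos (n₁ d k s : ℝ) (hn : 1 < n₁) (hd : 0 < d) (hk : 0 < k) : 0 < etaS n₁ d k s := by
  have := base_pos n₁ k hn hk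
  unfold etaS
  positivity

lemma etaS_cd (n₁ d k : ℝ) (hn : 1 < n₁) (hk : 0 < k) : ContDiff ℝ 1 (etaS n₁ d k) := by
  have := base_pos n₁ k hn hk
  unfold etaS
  refine contDiff_const.mul (ContDiff.sqrt (by fun_prop) fun s => ?_)
  positivity

lemma denS_pos (n₁ d k s : ℝ) (hn : 1 < n₁) (hd : 0 < d) (hk : 0 < k)
    (hcos : Real.cos (d * Real.sqrt (n₁ ^ 2 * k ^ 2 - k ^ 2)) ≠ 0) : 0 < denS n₁ d k s := by
  have he := etaS_pos n₁ d k s hn hd hk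
  unfold denS
  refine mul_pos Real.pi_pos ?_
  by_cases hc : Real.cos (etaS n₁ d k s) = 0
  · have hs : s ≠ 0 := by
      rintro rfl
      apply hcos
      simpa [etaS] using hc
    have h1 := Real.sin_sq_add_cos_sq (etaS n₁ d k s)
    rw [hc] at h1 ⊢
    have h2 : Real.sin (etaS n₁ d k s) ^ 2 = 1 := by linarith
    rw [h2]
    positivity
  · positivity

lemma wS_cd (n₁ d k : ℝ) (hn : 1 < n₁) (hd : 0 < d) (hk : 0 < k)
    (hcos : Real.cos (d * Real.sqrt (n₁ ^ 2 * k ^ 2 - k ^ 2)) ≠ 0) :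
    ContDiff ℝ 1 (wS n₁ d k) := by
  have := etaS_cd n₁ d k hn hk
  unfold wS
  refine ContDiff.div (by fun_prop) ?_ fun s => (denS_pos n₁ d k s hn hd hk hcos).ne'
  unfold denS
  have h1 := Real.contDiff_sin (n := 1) |>.comp this
  have h2 := Real.contDiff_cos (n := 1) |>.comp this
  exact contDiff_const.mul ((((contDiff_const.mul contDiff_id).pow 2).mul (h1.pow 2)).add
    ((this.pow 2).mul (h2.pow 2)))

lemma fIn_cd (n₁ d k : ℝ) (hn : 1 < n₁) (hk : 0 < k) :
    ContDiff ℝ 1 (fun p : ℝ × ℝ => fIn n₁ d k p.1 p.2) := by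
  have := (etaS_cd n₁ d k hn hk).comp (contDiff_fst (E := ℝ) (F := ℝ))
  unfold fIn
  exact Real.contDiff_sin.comp ((this.mul contDiff_snd).div_const d)

lemma fOut_cd (n₁ d k : ℝ) (hn : 1 < n₁) (hk : 0 < k) :
    ContDiff ℝ 1 (fun p : ℝ × ℝ => fOut n₁ d k p.1 p.2) := by
  have := (etaS_cd n₁ d k hn hk).comp (contDiff_fst (E := ℝ) (F := ℝ))
  have h1 := Real.contDiff_sin (n := 1) |>.comp this
  have h2 := Real.contDiff_cos (n := 1) |>.comp this
  have h3 : ContDiff ℝ 1 (fun p : ℝ × ℝ => p.1 * (p.2 - d)) := by fun_prop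
  have h4 : ContDiff ℝ 1 (fun p : ℝ × ℝ => p.2 - d) := by fun_prop
  unfold fOut
  exact (h1.mul (Real.contDiff_cos.comp h3)).add
    (((this.div_const d).mul h2).mul (h4.mul (sinc_cd.comp h3)))

lemma radPhi_prod (n₁ d k s x y : ℝ) (hn : 1 < n₁) (hd : 0 < d) (hk : 0 < k) (hs : 0 < s)
    (hcos : Real.cos (d * Real.sqrt (n₁ ^ 2 * k ^ 2 - k ^ 2)) ≠ 0) :
    radPhi n₁ d k (k ^ 2 - s ^ 2) x * radPhi n₁ d k (k ^ 2 - s ^ 2) y =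
      wS n₁ d k s * (if x ≤ d then fIn n₁ d k s x else fOut n₁ d k s x) *
        (if y ≤ d then fIn n₁ d k s y else fOut n₁ d k s y) := by
  have hden := denS_pos n₁ d k s hn hd hk hcos
  have hw : 0 ≤ wS n₁ d k s := by unfold wS; positivity
  have key : ∀ z, radPhi n₁ d k (k ^ 2 - s ^ 2) z =
      Real.sqrt (wS n₁ d k s) * (if z ≤ d then fIn n₁ d k s z else fOut n₁ d k s z) := by
    intro z
    have e1 : Real.sqrt (k ^ 2 - (k ^ 2 - s ^ 2)) = s := by
      rw [sub_sub_cancel, Real.sqrt_sq hs.le]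
    have e2 : d * Real.sqrt (n₁ ^ 2 * k ^ 2 - (k ^ 2 - s ^ 2)) = etaS n₁ d k s := by
      unfold etaS; congr 2; ring
    unfold radPhi
    simp only [e1, e2]
    split_ifs with hz
    · rfl
    · have hz' : z - d ≠ 0 := by
        intro h; apply hz; linarith
      have e3 : d * s * (z - d) / d = s * (z - d) := by field_simp
      rw [e3]
      unfold fOut
      rw [Real.sinc_of_ne_zero (mul_ne_zero hs.ne' hz')]
      congr 2
      field_simp
  rw [key x, key y]
  calc _ = (Real.sqrt (wS n₁ d k s) * Real.sqrt (wS n₁ d k s)) *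
        (if x ≤ d then fIn n₁ d k s x else fOut n₁ d k s x) *
        (if y ≤ d then fIn n₁ d k s y else fOut n₁ d k s y) := by ring
    _ = _ := by rw [Real.mul_self_sqrt hw]

lemma prod_cd (w : ℝ → ℝ) (f g : ℝ → ℝ → ℝ) (hw : ContDiff ℝ 1 w)
    (hf : ContDiff ℝ 1 (fun p : ℝ × ℝ => f p.1 p.2))
    (hg : ContDiff ℝ 1 (fun p : ℝ × ℝ => g p.1 p.2)) :
    ContDiff ℝ 1 (fun p : ℝ × ℝ × ℝ => w p.1 * f p.1 p.2.1 * g p.1 p.2.2) := by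
  have h1 : ContDiff ℝ 1 (fun p : ℝ × ℝ × ℝ => (p.1, p.2.1)) := by fun_prop
  have h2 : ContDiff ℝ 1 (fun p : ℝ × ℝ × ℝ => (p.1, p.2.2)) := by fun_prop
  exact ((hw.comp contDiff_fst).mul (hf.comp h1)).mul (hg.comp h2)

lemma image_sq (k ξ₀ : ℝ) :
    (fun s : ℝ => k ^ 2 - s ^ 2) '' Set.Ioo 0 (Real.sqrt (k ^ 2 - ξ₀)) = Set.Ioo ξ₀ (k ^ 2) := by
  ext γ
  constructor
  · rintro ⟨s, ⟨h1, h2⟩, rfl⟩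
    have := (Real.lt_sqrt h1.le).1 h2
    exact ⟨by simp only; linarith, by simp only; nlinarith⟩
  · rintro ⟨h1, h2⟩
    refine ⟨Real.sqrt (k ^ 2 - γ), ⟨Real.sqrt_pos.2 (by linarith), 
      Real.sqrt_lt_sqrt (by linarith) (by linarith)⟩, ?_⟩
    simp only
    rw [Real.sq_sqrt (by linarith)]; ring

/-- The radiating components of the refocused wave are of order `ε`, uniformly on bounded
sets: `|∫_{ξ₀}^{k²} φ_γ(x)φ_γ(y) e^{i√γ·L/ε} dγ| ≤ C·ε`. -/
theorem radiating_components_small (n₁ d k : ℝ) (hn : 1 < n₁) (hd : 0 < d) (hk : 0 < k)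
    (hcos : Real.cos (d * Real.sqrt (n₁ ^ 2 * k ^ 2 - k ^ 2)) ≠ 0) :
    ∀ ξ₀ ∈ Set.Ioo (0 : ℝ) (k ^ 2), ∀ L > (0 : ℝ), ∀ B > (0 : ℝ), ∃ C > (0 : ℝ),
      ∀ ε ∈ Set.Ioc (0 : ℝ) 1, ∀ x ∈ Set.Icc (0 : ℝ) B, ∀ y ∈ Set.Icc (0 : ℝ) B,
        ‖∫ γ in Set.Ioo ξ₀ (k ^ 2),
            ((radPhi n₁ d k γ x * radPhi n₁ d k γ y : ℝ) : ℂ) *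
              Complex.exp (Complex.I * (Real.sqrt γ * L / ε))‖ ≤ C * ε := by
  rintro ξ₀ ⟨hξ0, hξk⟩ L hL B hB
  set s0 := Real.sqrt (k ^ 2 - ξ₀) with hs0
  have hs : 0 < s0 := Real.sqrt_pos.2 (by linarith)
  have hsk : s0 < k := by
    rw [hs0, Real.sqrt_lt' hk]; linarith
  have hw := wS_cd n₁ d k hn hd hk hcos
  have hi := fIn_cd n₁ d k hn hk
  have ho := fOut_cd n₁ d k hn hk
  obtain ⟨C1, hC1, H1⟩ := osc_unif k s0 L B hk hs hsk hL _ (prod_cd _ _ _ hw hi hi)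
  obtain ⟨C2, hC2, H2⟩ := osc_unif k s0 L B hk hs hsk hL _ (prod_cd _ _ _ hw hi ho)
  obtain ⟨C3, hC3, H3⟩ := osc_unif k s0 L B hk hs hsk hL _ (prod_cd _ _ _ hw ho hi)
  obtain ⟨C4, hC4, H4⟩ := osc_unif k s0 L B hk hs hsk hL _ (prod_cd _ _ _ hw ho ho)
  refine ⟨C1 + C2 + C3 + C4, by positivity, ?_⟩
  rintro ε ⟨hε, -⟩ x hx y hy
  have hcv : ∫ γ in Set.Ioo ξ₀ (k ^ 2),
            ((radPhi n₁ d k γ x * radPhi n₁ d k γ y : ℝ) : ℂ) *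
              Complex.exp (Complex.I * (Real.sqrt γ * L / ε)) =
      ∫ s in Set.Ioo 0 s0, (2 * s : ℂ) * ((wS n₁ d k s *
        (if x ≤ d then fIn n₁ d k s x else fOut n₁ d k s x) *
        (if y ≤ d then fIn n₁ d k s y else fOut n₁ d k s y) : ℝ) : ℂ) *
        Complex.exp (Complex.I * ((Real.sqrt (k ^ 2 - s ^ 2) : ℝ) * L / ε)) := by
    rw [← image_sq k ξ₀]
    rw [integral_image_eq_integral_abs_deriv_smul measurableSet_Ioo
      (f' := fun s => -(2 * s))]
    · refine setIntegral_congr_fun measurableSet_Ioo fun s hs' => ?_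
      beta_reduce
      rw [radPhi_prod n₁ d k s x y hn hd hk hs'.1 hcos, abs_neg,
        abs_of_pos (mul_pos two_pos hs'.1), Complex.real_smul, mul_assoc]
      push_cast
      ring
    · intro s _
      have := ((hasDerivAt_pow 2 s).const_sub (k ^ 2)).hasDerivWithinAt
        (s := Set.Ioo 0 (Real.sqrt (k ^ 2 - ξ₀)))
      simpa using this
    · intro a ha b hb hab
      beta_reduce at hab
      have h2 : a ^ 2 = b ^ 2 := by linarith
      exact (sq_eq_sq₀ ha.1.le hb.1.le).1 h2
  rw [hcv]
  have m1 := mul_pos hC1 hε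
  have m2 := mul_pos hC2 hε
  have m3 := mul_pos hC3 hε
  have m4 := mul_pos hC4 hε
  by_cases hxd : x ≤ d <;> by_cases hyd : y ≤ d <;> simp only [hxd, hyd, if_true, if_false]
  · have := H1 ε hε x hx y hy
    refine this.trans ?_
    linarith
  · have := H2 ε hε x hx y hy
    refine this.trans ?_
    linarith
  · have := H3 ε hε x hx y hy
    refine this.trans ?_
    linarith
  · have := H4 ε hε x hx y hy
    refine this.trans ?_
    linarith
end
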